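/- arXiv:0904.2443 — 2 statements merged into one kernel-verified Lean document; each statement's English description precedes it below -/
import Mathlib

section
/- Let Q satisfy Assumption (A). Then Q^{*φ_Q} = Q, and for every ℓ > 0 and every e ∈ [e_{φ_Q,ℓ}, 0): Q^*(a_{φ_Q}(e,ℓ), ℓ) = F(e,ℓ). In particular, for every ℓ > 0, the function Q^*(·,ℓ) is C¹ on the interval (0, μ_Q(0,ℓ)). -/
noncomputable section

open MeasureTheory Real Filter Set Topology
open scoped ENNReal NNReal

abbrev E3 : Type := EuclideanSpace ℝ (Fin 3)
abbrev Phase : Type := E3 × E3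

/-- Spherical symmetry: invariance under all rotations of `ℝ³` acting jointly on `x` and `v`. -/
def SphSym (f : Phase → ℝ) : Prop :=
  ∀ R : E3 ≃ₗᵢ[ℝ] E3, LinearMap.det (R.toLinearEquiv : E3 →ₗ[ℝ] E3) = 1 →
    ∀ z : Phase, f (R z.1, R z.2) = f z

/-- `|x × v|²`, via the Lagrange identity. -/
def ellOf (z : Phase) : ℝ := ‖z.1‖ ^ 2 * ‖z.2‖ ^ 2 - (inner ℝ z.1 z.2 : ℝ) ^ 2

/-- Spatial density. -/
def rhoF (f : Phase → ℝ) (x : E3) : ℝ := ∫ v : E3, f (x, v)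

/-- Poisson field. -/
def phiF (f : Phase → ℝ) (x : E3) : ℝ := - ∫ y : E3, rhoF f y / (4 * π * ‖x - y‖)

/-- Radial representation of the Poisson field. -/
def phiRad (f : Phase → ℝ) (r : ℝ) : ℝ :=
  phiF f (r • (EuclideanSpace.single (0 : Fin 3) (1:ℝ)))

def mass (f : Phase → ℝ) : ℝ := ∫ z : Phase, f z

def kineticE (f : Phase → ℝ) : ℝ := ∫ z : Phase, ‖z.2‖ ^ 2 * f z

def gradPhi (f : Phase → ℝ) (x : E3) : E3 := gradient (phiF f) x

def fieldSq (f : Phase → ℝ) : ℝ := ∫ x : E3, ‖gradPhi f x‖ ^ 2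

/-- `L²` distance between the force fields of `f` and `g`. -/
def fieldDist (f g : Phase → ℝ) : ℝ :=
  Real.sqrt (∫ x : E3, ‖gradPhi f x - gradPhi g x‖ ^ 2)

/-- The Hamiltonian. -/
def Ham (f : Phase → ℝ) : ℝ := kineticE f / 2 - fieldSq f / 2

/-- The norm of the energy space. -/
def eNormE (f : Phase → ℝ) : ℝ≥0∞ :=
  eLpNorm f 1 volume + eLpNorm f ⊤ volume +
    ∫⁻ z : Phase, (‖z.2‖₊ : ℝ≥0∞) ^ 2 * (‖f z‖₊ : ℝ≥0∞)

def memE (f : Phase → ℝ) : Prop := Measurable f ∧ (∀ z, 0 ≤ f z) ∧ eNormE f < ⊤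

def memErad (f : Phase → ℝ) : Prop := memE f ∧ SphSym f

/-- Density of the measure `ν_ℓ`. -/
def nuDens (ℓ : ℝ) (p : ℝ × ℝ) : ℝ≥0∞ :=
  if 0 < p.1 ∧ ℓ < p.1 ^ 2 * p.2 ^ 2 then
    ENNReal.ofReal (4 * π ^ 2 * p.1 * |p.2| / Real.sqrt (p.1 ^ 2 * p.2 ^ 2 - ℓ))
  else 0

def nuMeas (ℓ : ℝ) : Measure (ℝ × ℝ) := volume.withDensity (nuDens ℓ)

/-- Representative phase point with `|x| = r`, `|v| = |u|`, `|x×v|² = ℓ` and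
`x·v = sign u · √(r²u²-ℓ)`. -/
def radPoint (r u ℓ : ℝ) : Phase :=
  (r • (EuclideanSpace.single (0 : Fin 3) (1:ℝ)),
   (Real.sign u * Real.sqrt (r ^ 2 * u ^ 2 - ℓ) / r) • (EuclideanSpace.single (0 : Fin 3) (1:ℝ))
     + (Real.sqrt ℓ / r) • (EuclideanSpace.single (1 : Fin 3) (1:ℝ)))

/-- Distribution function of `f` at kinetic momentum `ℓ`. -/
def muDist (f : Phase → ℝ) (s ℓ : ℝ) : ℝ≥0∞ :=
  nuMeas ℓ {p : ℝ × ℝ | s < f (radPoint p.1 p.2 ℓ)}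

/-- `g ∈ Eq(f)` : `g` is nonnegative, spherically symmetric and equimeasurable to `f`
at (almost) every kinetic momentum `ℓ`. -/
def EqMeas (f g : Phase → ℝ) : Prop :=
  (∀ z, 0 ≤ g z) ∧ SphSym g ∧
    ∀ s : ℝ, 0 < s →
      ∀ᵐ ℓ ∂(volume.restrict (Ioi (0:ℝ))), muDist g s ℓ = muDist f s ℓ

/-- Schwarz symmetrization of `f` at fixed `ℓ`. -/
def schwarz (f : Phase → ℝ) (t ℓ : ℝ) : ℝ :=
  if ENNReal.ofReal t < muDist f 0 ℓ then
    sSup {s : ℝ | 0 ≤ s ∧ ENNReal.ofReal t < muDist f s ℓ}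
  else 0

/-- Effective potential. -/
def psiPot (φ : ℝ → ℝ) (ℓ r : ℝ) : ℝ := φ r + ℓ / (2 * r ^ 2)

def eMinPot (φ : ℝ → ℝ) (ℓ : ℝ) : ℝ := sInf (psiPot φ ℓ '' Ioi 0)

def r1Pot (φ : ℝ → ℝ) (e ℓ : ℝ) : ℝ := sInf {r : ℝ | 0 < r ∧ psiPot φ ℓ r < e}

def r2Pot (φ : ℝ → ℝ) (e ℓ : ℝ) : ℝ := sSup {r : ℝ | 0 < r ∧ psiPot φ ℓ r < e}

/-- The Jacobian `a_φ(e, ℓ)` (meaningful for `e < 0`). -/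
def aPot (φ : ℝ → ℝ) (e ℓ : ℝ) : ℝ :=
  8 * π ^ 2 * Real.sqrt 2 * ∫ r in Ioi (0:ℝ), Real.sqrt (max (e - psiPot φ ℓ r) 0)

/-- Inverse of the bijection `e ↦ a_φ(e,ℓ)` from `(e_{φ,ℓ},0)` onto `(0,∞)`. -/
def aPotInv (φ : ℝ → ℝ) (s ℓ : ℝ) : ℝ :=
  sSup {e : ℝ | eMinPot φ ℓ < e ∧ e < 0 ∧ aPot φ e ℓ < s}

/-- Microscopic energy w.r.t. the Poisson field of `g`. -/
def microE (g : Phase → ℝ) (z : Phase) : ℝ := ‖z.2‖ ^ 2 / 2 + phiF g z.1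

/-- Rearrangement of `f` with respect to the microscopic energy of the field of `g`. -/
def rearr (f g : Phase → ℝ) (z : Phase) : ℝ :=
  if microE g z < 0 then
    schwarz f (aPot (phiRad g) (microE g z) (ellOf z)) (ellOf z)
  else 0

/-- Assumption (A). -/
structure AssumptionA (Q : Phase → ℝ) (F : ℝ → ℝ → ℝ) (e₀ : ℝ) : Prop where
  contQ : Continuous Q
  nonneg : ∀ z, 0 ≤ Q z
  nonzero : Q ≠ 0
  cpt : HasCompactSupport Q
  sph : SphSym Q
  eqF : ∀ z : Phase, Q z = F (microE Q z) (ellOf z)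
  Fnonneg : ∀ e ℓ, 0 ≤ ℓ → 0 ≤ F e ℓ
  Fcont : ContinuousOn (fun p : ℝ × ℝ => F p.1 p.2) {p : ℝ × ℝ | 0 ≤ p.2}
  e₀neg : e₀ < 0
  Fsupp : ∀ e ℓ, 0 ≤ ℓ → 0 < F e ℓ → e < e₀
  FC1 : ContDiffOn ℝ 1 (fun p : ℝ × ℝ => F p.1 p.2) {p : ℝ × ℝ | 0 ≤ p.2 ∧ 0 < F p.1 p.2}
  FeNeg : ∀ e ℓ, 0 ≤ ℓ → 0 < F e ℓ → deriv (fun e' => F e' ℓ) e < 0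

/-- The reduced functional `J_{f^*}(φ_g) = H(f^{*φ_g}) + ½|∇φ_g − ∇φ_{f^{*φ_g}}|²`. -/
def Jred (f g : Phase → ℝ) : ℝ :=
  Ham (rearr f g) + (∫ x : E3, ‖gradPhi g x - gradPhi (rearr f g) x‖ ^ 2) / 2

def distL1 (f g : Phase → ℝ) : ℝ := ∫ z : Phase, |f z - g z|

def distL1v (f g : Phase → ℝ) : ℝ := ∫ z : Phase, ‖z.2‖ ^ 2 * |f z - g z|



lemma lint_E3 (f : E3 → ℝ≥0∞) (hf : Measurable f) :
    ∫⁻ y, f y = ∫⁻ a : ℝ, ∫⁻ q : ℝ × ℝ, f (!₂[a, q.1, q.2]) := by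
  rw [← (PiLp.volume_preserving_toLp (Fin 3)).lintegral_comp hf]
  have h1 := (volume_preserving_piFinSuccAbove (fun _ : Fin 3 => ℝ) 0).symm
  rw [← h1.lintegral_comp_emb (MeasurableEquiv.measurableEmbedding _)]
  have h2 : MeasurePreserving (Prod.map id (MeasurableEquiv.finTwoArrow (α := ℝ)).symm)
      (volume : Measure (ℝ × (ℝ × ℝ))) (volume : Measure (ℝ × (Fin 2 → ℝ))) :=
    (MeasurePreserving.id volume).prod (volume_preserving_finTwoArrow ℝ).symm
  have hm : Measurable fun a : ℝ × (Fin 2 → ℝ) => f (WithLp.toLp 2 ((MeasurableEquiv.piFinSuccAbove (fun _ : Fin 3 => ℝ) 0).symm a)) :=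
    hf.comp ((PiLp.volume_preserving_toLp (Fin 3)).measurable.comp (MeasurableEquiv.measurable _))
  have := h2.lintegral_comp hm
  refine this.symm.trans ?_
  rw [Measure.volume_eq_prod, lintegral_prod]
  · refine lintegral_congr fun a => lintegral_congr fun q => ?_
    congr 1
    ext i
    fin_cases i <;> rfl
  · exact (hm.comp h2.measurable).aemeasurable

lemma newton_ang {r s : ℝ} (hr : 0 < r) (hs : 0 < s) :
    ∫⁻ θ in Ioo 0 π, ENNReal.ofReal (sin θ / √(r ^ 2 + s ^ 2 - 2 * r * s * cos θ)) =
      ENNReal.ofReal (2 * min r s / (r * s)) := by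
  set D : ℝ → ℝ := fun θ => r ^ 2 + s ^ 2 - 2 * r * s * cos θ with hD
  have hrs : 0 < r * s := mul_pos hr hs
  have hcont : ContinuousOn (fun θ => √(D θ) / (r * s)) (Icc 0 π) := by
    apply Continuous.continuousOn; fun_prop
  have hpos : ∀ θ ∈ Ioo 0 π, 0 < D θ := by
    intro θ hθ
    have h1 : cos θ < 1 := by
      have := sin_pos_of_mem_Ioo hθ
      nlinarith [sin_sq_add_cos_sq θ, cos_le_one θ]
    have : 0 < r * s * (1 - cos θ) := mul_pos hrs (by linarith)
    simp only [hD]; nlinarith [sq_nonneg (r - s)]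
  have hder : ∀ θ ∈ Ioo 0 π, HasDerivAt (fun θ => √(D θ) / (r * s)) (sin θ / √(D θ)) θ := by
    intro θ hθ
    have h1 : HasDerivAt D (2 * r * s * sin θ) θ := by
      have := ((hasDerivAt_cos θ).const_mul (2 * r * s)).const_sub (r ^ 2 + s ^ 2)
      refine this.congr_deriv ?_; ring
    have h2 := (h1.sqrt (hpos θ hθ).ne').div_const (r * s)
    refine h2.congr_deriv ?_
    have := Real.sqrt_pos.2 (hpos θ hθ)
    field_simp
  have hnn : ∀ θ ∈ Ioo 0 π, 0 ≤ sin θ / √(D θ) := fun θ hθ =>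
    div_nonneg (sin_pos_of_mem_Ioo hθ).le (Real.sqrt_nonneg _)
  have hint : IntegrableOn (fun θ => sin θ / √(D θ)) (Ioc 0 π) :=
    intervalIntegral.integrableOn_deriv_of_nonneg hcont hder hnn
  have hval := intervalIntegral.integral_eq_sub_of_hasDerivAt_of_le pi_pos.le hcont hder
    ((intervalIntegrable_iff_integrableOn_Ioc_of_le pi_pos.le).2 hint)
  rw [intervalIntegral.integral_of_le pi_pos.le, integral_Ioc_eq_integral_Ioo] at hval
  rw [← ofReal_integral_eq_lintegral_ofReal (hint.mono_set Ioo_subset_Ioc_self)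
    ((ae_restrict_iff' measurableSet_Ioo).2 (ae_of_all _ hnn)), hval]
  congr 1
  simp only [hD, cos_pi, cos_zero]
  rw [show r ^ 2 + s ^ 2 - 2 * r * s * -1 = (r + s) ^ 2 by ring,
    show r ^ 2 + s ^ 2 - 2 * r * s * 1 = (r - s) ^ 2 by ring, Real.sqrt_sq (by positivity),
    Real.sqrt_sq_eq_abs]
  rw [← sub_div]
  congr 1
  rcases le_total r s with h | h
  · rw [min_eq_left h, abs_of_nonpos (by linarith)]; ring
  · rw [min_eq_right h, abs_of_nonneg (by linarith)]; ring

lemma newton (g : ℝ → ℝ) (hg : Measurable g) (hg0 : ∀ s, 0 ≤ g s) {r : ℝ} (hr : 0 < r) :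
    ∫⁻ y : E3, ENNReal.ofReal (g ‖y‖ /
      (4 * π * ‖r • (EuclideanSpace.single (0 : Fin 3) (1:ℝ) : E3) - y‖)) =
    ∫⁻ s in Ioi (0:ℝ), ENNReal.ofReal (s * g s * min r s / r) := by
  set G : ℝ → ℝ → ℝ≥0∞ := fun a q => ENNReal.ofReal (g (√(a ^ 2 + q)) /
    (4 * π * √((r - a) ^ 2 + q))) with hG
  have hGm : Measurable (fun p : ℝ × ℝ => G p.1 p.2) := by
    simp only [hG]; fun_prop
  rw [lint_E3 _ (by fun_prop)]
  have e1 : ∀ a : ℝ, ∀ q : ℝ × ℝ, ENNReal.ofReal (g ‖(!₂[a, q.1, q.2] : E3)‖ /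
      (4 * π * ‖r • (EuclideanSpace.single (0 : Fin 3) (1:ℝ) : E3) - !₂[a, q.1, q.2]‖)) =
      G a (q.1 ^ 2 + q.2 ^ 2) := by
    intro a q
    simp only [hG, EuclideanSpace.norm_eq, Fin.sum_univ_three]
    simp [add_assoc]
  simp_rw [e1]
  have e2 : ∀ a : ℝ, ∫⁻ q : ℝ × ℝ, G a (q.1 ^ 2 + q.2 ^ 2) =
      ∫⁻ t, ENNReal.ofReal (2 * π) * (Ioi (0:ℝ)).indicator (fun t => ENNReal.ofReal t * G a (t ^ 2)) t := by
    intro a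
    have hGa : Measurable (G a) := by simp only [hG]; fun_prop
    rw [← lintegral_comp_polarCoord_symm, polarCoord_target, Measure.volume_eq_prod,
      ← Measure.prod_restrict, lintegral_prod, lintegral_const_mul, lintegral_indicator measurableSet_Ioi,
      ← lintegral_const_mul]
    · refine lintegral_congr fun t => ?_
      have : ∀ θ : ℝ, ENNReal.ofReal t • G a ((polarCoord.symm (t, θ)).1 ^ 2 + (polarCoord.symm (t, θ)).2 ^ 2)
        = ENNReal.ofReal t * G a (t ^ 2) := by
        intro θ
        simp only [polarCoord_symm_apply, smul_eq_mul]
        congr 2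
        linear_combination t ^ 2 * sin_sq_add_cos_sq θ
      simp only [this]
      rw [lintegral_const, mul_comm]
      congr 1
      rw [Measure.restrict_apply_univ, Real.volume_Ioo]; congr 1; ring
    · fun_prop
    · exact Measurable.indicator (by fun_prop) measurableSet_Ioi
    · apply Measurable.aemeasurable
      simp only [polarCoord_symm_apply]
      fun_prop
  simp_rw [e2]
  have hHm : Measurable (fun p : ℝ × ℝ => ENNReal.ofReal (2 * π) * (Ioi (0:ℝ)).indicator (fun t => ENNReal.ofReal t * G p.1 (t ^ 2)) p.2) := by
    have h1 : Measurable (fun p : ℝ × ℝ => ENNReal.ofReal p.2 * G p.1 (p.2 ^ 2)) := by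
      simp only [hG]; fun_prop
    have h2 : MeasurableSet {p : ℝ × ℝ | 0 < p.2} := measurableSet_lt (by fun_prop) (by fun_prop)
    exact (h1.indicator h2).const_mul _
  rw [← lintegral_prod (fun p : ℝ × ℝ => ENNReal.ofReal (2 * π) * (Ioi (0:ℝ)).indicator (fun t => ENNReal.ofReal t * G p.1 (t ^ 2)) p.2)]
  swap
  · exact hHm.aemeasurable
  rw [← Measure.volume_eq_prod, ← lintegral_comp_polarCoord_symm, polarCoord_target, Measure.volume_eq_prod,
      ← Measure.prod_restrict, lintegral_prod]
  swap
  · apply Measurable.aemeasurable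
    have h3 : Measurable (fun p : ℝ × ℝ => polarCoord.symm p) := by
      simp only [polarCoord_symm_apply]; fun_prop
    exact Measurable.mul (by fun_prop) (hHm.comp h3)
  refine setLIntegral_congr_fun measurableSet_Ioi fun s hs => ?_
  have hs : 0 < s := hs
  have e3 : ∀ θ ∈ Ioo (-π) π, ENNReal.ofReal s • (ENNReal.ofReal (2 * π) * (Ioi (0:ℝ)).indicator (fun t => ENNReal.ofReal t * G (polarCoord.symm (s, θ)).1 (t ^ 2)) (polarCoord.symm (s, θ)).2)
     = (Ioo 0 π).indicator (fun θ => ENNReal.ofReal (s ^ 2 * g s / 2) * ENNReal.ofReal (sin θ / √(r ^ 2 + s ^ 2 - 2 * r * s * cos θ))) θ := by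
    intro θ hθ
    simp only [polarCoord_symm_apply]
    by_cases h : 0 < θ
    · have hsin : 0 < sin θ := sin_pos_of_mem_Ioo ⟨h, hθ.2⟩
      rw [indicator_of_mem (show s * sin θ ∈ Ioi 0 from mul_pos hs hsin), indicator_of_mem (show θ ∈ Ioo 0 π from ⟨h, hθ.2⟩)]
      simp only [hG, smul_eq_mul]
      rw [← ENNReal.ofReal_mul (mul_pos hs hsin).le, ← ENNReal.ofReal_mul (by positivity),
        ← ENNReal.ofReal_mul hs.le, ← ENNReal.ofReal_mul (by have := hg0 s; positivity)]
      congr 1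
      rw [show (s * cos θ) ^ 2 + (s * sin θ) ^ 2 = s ^ 2 by
          linear_combination s ^ 2 * sin_sq_add_cos_sq θ,
        show (r - s * cos θ) ^ 2 + (s * sin θ) ^ 2 = r ^ 2 + s ^ 2 - 2 * r * s * cos θ by
          linear_combination s ^ 2 * sin_sq_add_cos_sq θ, Real.sqrt_sq hs.le]
      field_simp; ring
    · rw [indicator_of_notMem, indicator_of_notMem]
      · simp
      · exact fun h' => h h'.1
      · intro h'
        have h1 : sin θ ≤ 0 := sin_nonpos_of_nonpos_of_neg_pi_le (by linarith) hθ.1.le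
        have h2 : 0 < s * sin θ := h'
        nlinarith
  rw [setLIntegral_congr_fun measurableSet_Ioo e3, lintegral_indicator measurableSet_Ioo,
    Measure.restrict_restrict measurableSet_Ioo,
    inter_eq_left.2 (Ioo_subset_Ioo (by linarith [pi_pos]) le_rfl), lintegral_const_mul _ (by fun_prop),
    newton_ang hr hs, ← ENNReal.ofReal_mul (by have := hg0 s; positivity)]
  congr 1
  field_simp

lemma exists_rot (x y : E3) (h : ‖x‖ = ‖y‖) :
    ∃ R : E3 ≃ₗᵢ[ℝ] E3, LinearMap.det (R.toLinearEquiv : E3 →ₗ[ℝ] E3) = 1 ∧ R x = y := by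
  by_cases hxy : x = y
  · refine ⟨LinearIsometryEquiv.refl ℝ E3, ?_, by simpa using hxy⟩
    exact LinearMap.det_id
  have key : ∀ w : E3, w ≠ 0 →
      LinearMap.det (((ℝ ∙ w)ᗮ.reflection).toLinearEquiv : E3 →ₗ[ℝ] E3) = -1 := by
    intro w hw
    have := Submodule.det_reflection ((ℝ ∙ w)ᗮ)
    rw [Submodule.orthogonal_orthogonal, finrank_span_singleton hw, pow_one] at this
    exact this
  have hw : ∃ w : E3, w ≠ 0 ∧ w ∈ (ℝ ∙ y)ᗮ := by
    by_contra! hcon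
    have h1 : (ℝ ∙ y)ᗮ = ⊥ := by
      rw [Submodule.eq_bot_iff]; intro w hw; by_contra h0; exact hcon w h0 hw
    have h2 := Submodule.finrank_add_finrank_orthogonal (ℝ ∙ y)
    have h3 : Module.finrank ℝ (ℝ ∙ y) ≤ 1 := by
      by_cases hy : y = 0
      · rw [hy, Submodule.span_zero_singleton, finrank_bot]; norm_num
      · rw [finrank_span_singleton hy]
    rw [h1] at h2
    simp at h2
    omega
  obtain ⟨w, hw0, hwy⟩ := hw
  refine ⟨((ℝ ∙ (x - y))ᗮ.reflection).trans ((ℝ ∙ w)ᗮ.reflection), ?_, ?_⟩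
  · have : ((((ℝ ∙ (x - y))ᗮ.reflection).trans ((ℝ ∙ w)ᗮ.reflection)).toLinearEquiv : E3 →ₗ[ℝ] E3)
      = (((ℝ ∙ w)ᗮ.reflection).toLinearEquiv : E3 →ₗ[ℝ] E3) ∘ₗ
        (((ℝ ∙ (x - y))ᗮ.reflection).toLinearEquiv : E3 →ₗ[ℝ] E3) := rfl
    rw [this, LinearMap.det_comp, key w hw0, key _ (sub_ne_zero.2 hxy)]
    norm_num
  · rw [LinearIsometryEquiv.trans_apply, Submodule.reflection_sub h]
    rw [Submodule.reflection_eq_self_iff, Submodule.mem_orthogonal_singleton_iff_inner_right]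
    rw [Submodule.mem_orthogonal_singleton_iff_inner_right] at hwy
    rw [real_inner_comm]; exact hwy

def e0v : E3 := EuclideanSpace.single (0 : Fin 3) (1:ℝ)

lemma norm_e0v : ‖e0v‖ = 1 := by simp [e0v]

lemma norm_smul_e0v {r : ℝ} (hr : 0 ≤ r) : ‖r • e0v‖ = r := by
  rw [norm_smul, norm_e0v, mul_one, Real.norm_of_nonneg hr]

lemma rho_rot {Q : Phase → ℝ} (hs : SphSym Q) (R : E3 ≃ₗᵢ[ℝ] E3)
    (hR : LinearMap.det (R.toLinearEquiv : E3 →ₗ[ℝ] E3) = 1) (x : E3) :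
    rhoF Q (R x) = rhoF Q x := by
  unfold rhoF
  rw [← (R.measurePreserving).integral_comp R.toHomeomorph.measurableEmbedding]
  exact integral_congr_ae (ae_of_all _ fun v => hs R hR (x, v))

lemma rho_rad {Q : Phase → ℝ} (hs : SphSym Q) (x : E3) : rhoF Q x = rhoF Q (‖x‖ • e0v) := by
  obtain ⟨R, hR, h⟩ := exists_rot x (‖x‖ • e0v) (by rw [norm_smul_e0v (norm_nonneg _)])
  rw [← h, rho_rot hs R hR]

lemma phi_rad {Q : Phase → ℝ} (hs : SphSym Q) (x : E3) : phiF Q x = phiRad Q ‖x‖ := by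
  obtain ⟨R, hR, h⟩ := exists_rot x (‖x‖ • e0v) (by rw [norm_smul_e0v (norm_nonneg _)])
  change phiF Q x = phiF Q (‖x‖ • e0v)
  rw [← h]
  unfold phiF
  congr 1
  rw [← (R.measurePreserving).integral_comp R.toHomeomorph.measurableEmbedding
    (fun y => rhoF Q y / (4 * π * ‖R x - y‖))]
  refine integral_congr_ae (ae_of_all _ fun y => ?_)
  simp only
  rw [rho_rot hs R hR, ← map_sub, R.norm_map]

lemma rho_nonneg {Q : Phase → ℝ} (h : ∀ z, 0 ≤ Q z) (x : E3) : 0 ≤ rhoF Q x :=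
  integral_nonneg fun _ => h _

lemma rho_cont {Q : Phase → ℝ} (hc : Continuous Q) (hK : HasCompactSupport Q) :
    Continuous (rhoF Q) ∧ ∃ S : ℝ, ∀ x, S < ‖x‖ → rhoF Q x = 0 := by
  obtain ⟨S, hS⟩ := hK.isCompact.isBounded.subset_closedBall 0
  have hz : ∀ z : Phase, S < ‖z‖ → Q z = 0 := by
    intro z hz
    by_contra h
    have := hS (subset_tsupport _ h)
    rw [mem_closedBall_zero_iff] at this
    linarith
  constructor
  · have : rhoF Q = fun x => ∫ v in Metric.closedBall (0 : E3) S, Q (x, v) := by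
      ext x
      unfold rhoF
      rw [setIntegral_eq_integral_of_forall_compl_eq_zero]
      intro v hv
      apply hz
      rw [mem_closedBall_zero_iff, not_le] at hv
      exact hv.trans_le (norm_snd_le (x, v))
    rw [this]
    exact continuous_parametric_integral_of_continuous (f := fun x v => Q (x, v)) hc
      (isCompact_closedBall _ _)
  · refine ⟨S, fun x hx => ?_⟩
    unfold rhoF
    rw [integral_eq_zero_of_ae (ae_of_all _ fun v => ?_)]
    exact hz _ (hx.trans_le (norm_fst_le (x, v)))

lemma phi_formula {Q : Phase → ℝ} (hc : Continuous Q) (hK : HasCompactSupport Q)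
    (h0 : ∀ z, 0 ≤ Q z) (hs : SphSym Q) {r : ℝ} (hr : 0 < r) :
    r * phiRad Q r = - ∫ s in Ioi (0:ℝ), s * rhoF Q (s • e0v) * min r s := by
  obtain ⟨hρ, S, hS⟩ := rho_cont hc hK
  have hg : Continuous fun s : ℝ => rhoF Q (s • e0v) := by fun_prop
  have hN := newton (fun s => rhoF Q (s • e0v)) hg.measurable (fun s => rho_nonneg h0 _) hr
  have h1 : phiRad Q r = - ∫ y : E3, rhoF Q (‖y‖ • e0v) / (4 * π * ‖r • e0v - y‖) := by
    unfold phiRad phiF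
    congr 1
    refine integral_congr_ae (ae_of_all _ fun y => ?_)
    simp only
    rw [rho_rad hs y]; rfl
  have h2 : ∫ s in Ioi (0:ℝ), s * rhoF Q (s • e0v) * min r s
      = r * ∫ s in Ioi (0:ℝ), s * rhoF Q (s • e0v) * min r s / r := by
    rw [integral_div]; field_simp
  rw [h1, h2, mul_neg]
  congr 2
  rw [integral_eq_lintegral_of_nonneg_ae, integral_eq_lintegral_of_nonneg_ae]
  · exact congrArg ENNReal.toReal hN
  · refine (ae_restrict_iff' measurableSet_Ioi).2 (ae_of_all _ fun s hs => ?_)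
    have h3 : 0 < s := hs
    have := rho_nonneg h0 (s • e0v)
    have : 0 ≤ min r s := le_min hr.le h3.le
    simp only [Pi.zero_apply]; positivity
  · apply Continuous.aestronglyMeasurable; fun_prop
  · refine ae_of_all _ fun y => ?_
    have := rho_nonneg h0 (‖y‖ • e0v)
    simp only [Pi.zero_apply]; positivity
  · apply Measurable.aestronglyMeasurable
    have := hg.measurable
    have h4 : Measurable fun y : E3 => rhoF Q (‖y‖ • e0v) := this.comp measurable_norm
    fun_prop

lemma phi_props {Q : Phase → ℝ} (hc : Continuous Q) (hK : HasCompactSupport Q)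
    (h0 : ∀ z, 0 ≤ Q z) (hs : SphSym Q) :
    ConvexOn ℝ (Ioi 0) (fun r => r * phiRad Q r) ∧ ∃ M, 0 ≤ M ∧ ∀ r, 0 < r → -M ≤ r * phiRad Q r := by
  obtain ⟨hρ, S, hS⟩ := rho_cont hc hK
  have hg : Continuous fun s : ℝ => rhoF Q (s • e0v) := by fun_prop
  have hint : ∀ p : ℝ → ℝ, Continuous p →
      IntegrableOn (fun s => s * rhoF Q (s • e0v) * p s) (Ioi 0) := by
    intro p hp
    have hc' : Continuous (fun s => s * rhoF Q (s • e0v) * p s) := by fun_prop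
    refine (hc'.integrableOn_Icc (a := 0) (b := S)).of_forall_sdiff_eq_zero measurableSet_Ioi ?_
    intro s hs
    have h1 : 0 < s := hs.1
    have h2 : S < s := by
      by_contra h; exact hs.2 ⟨h1.le, not_lt.1 h⟩
    rw [hS (s • e0v) (by rwa [norm_smul_e0v h1.le])]; ring
  have hmin : ∀ r : ℝ, Continuous (fun s => min r s) := fun r => by fun_prop
  constructor
  · refine ⟨convex_Ioi 0, fun x hx y hy a b ha hb hab => ?_⟩
    have hxy : 0 < a • x + b • y := (convex_Ioi (0:ℝ)) hx hy ha hb hab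
    simp only [smul_eq_mul] at *
    rw [phi_formula hc hK h0 hs hxy, phi_formula hc hK h0 hs hx, phi_formula hc hK h0 hs hy,
      mul_neg, mul_neg, ← neg_add, neg_le_neg_iff, ← integral_const_mul, ← integral_const_mul,
      ← integral_add ((hint _ (hmin x)).const_mul a) ((hint _ (hmin y)).const_mul b)]
    refine setIntegral_mono_on (((hint _ (hmin x)).const_mul a).add ((hint _ (hmin y)).const_mul b)) (hint _ (hmin _)) measurableSet_Ioi fun s hs => ?_
    have h3 : 0 < s := hs
    have h4 := rho_nonneg h0 (s • e0v)
    have h5 : a * min x s + b * min y s ≤ min (a * x + b * y) s := by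
      apply le_min
      · gcongr <;> exact min_le_left _ _
      · calc a * min x s + b * min y s ≤ a * s + b * s := by gcongr <;> exact min_le_right _ _
          _ = s := by rw [← add_mul, hab, one_mul]
    have h6 := mul_le_mul_of_nonneg_left h5 (mul_nonneg h3.le h4)
    linarith
  · refine ⟨∫ s in Ioi (0:ℝ), s * rhoF Q (s • e0v) * s, ?_, fun r hr => ?_⟩
    · refine setIntegral_nonneg measurableSet_Ioi fun s hs => ?_
      have h3 : 0 < s := hs
      have h4 := rho_nonneg h0 (s • e0v)
      positivity
    · rw [phi_formula hc hK h0 hs hr, neg_le_neg_iff]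
      refine setIntegral_mono_on (hint _ (hmin _)) (hint _ continuous_id) measurableSet_Ioi fun s hs => ?_
      have h3 : 0 < s := hs
      have h4 := rho_nonneg h0 (s • e0v)
      gcongr
      exact min_le_right _ _

structure GoodPot (φ : ℝ → ℝ) : Prop where
  conv : ConvexOn ℝ (Ioi 0) (fun r => r * φ r)
  low : ∃ M, 0 ≤ M ∧ ∀ r, 0 < r → -M ≤ r * φ r

lemma GoodPot.convPsi {φ : ℝ → ℝ} (h : GoodPot φ) {ℓ : ℝ} (hℓ : 0 < ℓ) :
    ConvexOn ℝ (Ioi 0) (fun r => r * psiPot φ ℓ r) := by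
  have h1 : ConvexOn ℝ (Ioi 0) (fun r : ℝ => (ℓ / 2) * r ^ (-1 : ℤ)) :=
    (convexOn_zpow (-1)).smul (by positivity : (0:ℝ) ≤ ℓ / 2)
  refine (h.conv.add h1).congr ?_
  intro r hr
  have hr : 0 < r := hr
  simp only [psiPot, Pi.add_apply, zpow_neg, zpow_one]
  field_simp

lemma GoodPot.contPhi {φ : ℝ → ℝ} (h : GoodPot φ) : ContinuousOn φ (Ioi 0) := by
  have h1 := h.conv.continuousOn isOpen_Ioi
  have h2 : ContinuousOn (fun r => (r * φ r) / r) (Ioi 0) :=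
    h1.div continuousOn_id fun r hr => (ne_of_gt hr)
  refine h2.congr fun r hr => ?_
  have hr : 0 < r := hr
  simp only
  field_simp

lemma GoodPot.contPsi {φ : ℝ → ℝ} (h : GoodPot φ) (ℓ : ℝ) : ContinuousOn (psiPot φ ℓ) (Ioi 0) := by
  refine h.contPhi.add (continuousOn_const.div (by fun_prop) fun r hr => ?_)
  have hr : 0 < r := hr
  positivity

lemma GoodPot.lowPsi {φ : ℝ → ℝ} (h : GoodPot φ) {ℓ : ℝ} (hℓ : 0 < ℓ) {e : ℝ} (he : e < 0) :
    ∃ α β, 0 < α ∧ α < β ∧ (∀ r, 0 < r → r ≤ α → e < psiPot φ ℓ r) ∧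
      (∀ r, β ≤ r → e < psiPot φ ℓ r) := by
  obtain ⟨M, hM0, hM⟩ := h.low
  have hphi : ∀ r, 0 < r → -M / r ≤ φ r := fun r hr => by
    rw [div_le_iff₀ hr, mul_comm]; exact hM r hr
  refine ⟨ℓ / (2 * (M + 1)), ℓ / (2 * (M + 1)) + (M + 1) / (-e), by positivity, ?_, ?_, ?_⟩
  · have : 0 < (M + 1) / (-e) := div_pos (by linarith) (by linarith)
    linarith
  · intro r hr hrα
    have h1 := hphi r hr
    have h2 : M / r ≤ ℓ / (2 * r ^ 2) := by
      rw [div_le_div_iff₀ hr (by positivity)]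
      rw [le_div_iff₀ (by positivity)] at hrα
      nlinarith
    have h3 : -M / r = -(M / r) := by ring
    unfold psiPot; linarith
  · intro r hr
    have h0 : 0 < (M + 1) / (-e) := div_pos (by linarith) (by linarith)
    have h00 : 0 < ℓ / (2 * (M + 1)) := by positivity
    have hr0 : 0 < r := by linarith
    have h1 := hphi r hr0
    have h2 : 0 < ℓ / (2 * r ^ 2) := by positivity
    have h3 : e ≤ -M / r := by
      rw [le_div_iff₀ hr0]
      have : (M + 1) / (-e) ≤ r := by linarith
      rw [div_le_iff₀ (by linarith)] at this
      linarith
    unfold psiPot; linarith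

lemma GoodPot.bddPsi {φ : ℝ → ℝ} (h : GoodPot φ) {ℓ : ℝ} (hℓ : 0 < ℓ) :
    BddBelow (psiPot φ ℓ '' Ioi 0) := by
  obtain ⟨M, hM0, hM⟩ := h.low
  refine ⟨-(M ^ 2 / (2 * ℓ)), ?_⟩
  rintro _ ⟨r, hr, rfl⟩
  have hr : 0 < r := hr
  have h1 : -M / r ≤ φ r := by
    rw [div_le_iff₀ hr, mul_comm]; exact hM r hr
  have h2 : -(M ^ 2 / (2 * ℓ)) ≤ -M / r + ℓ / (2 * r ^ 2) := by
    have : -M / r + ℓ / (2 * r ^ 2) + M ^ 2 / (2 * ℓ) = (M * r - ℓ) ^ 2 / (2 * ℓ * r ^ 2) := by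
      field_simp; ring
    have h3 : 0 ≤ (M * r - ℓ) ^ 2 / (2 * ℓ * r ^ 2) := by positivity
    linarith
  unfold psiPot; linarith

/-- weighted quasi-convexity -/
lemma GoodPot.chord {φ : ℝ → ℝ} (h : GoodPot φ) {ℓ : ℝ} (hℓ : 0 < ℓ) {a c θ e : ℝ}
    (ha : 0 < a) (hc : 0 < c) (h0 : 0 ≤ θ) (h1 : θ ≤ 1) (hce : psiPot φ ℓ c ≤ e) :
    (1 - θ) * a * (e - psiPot φ ℓ a) ≤
      (a + θ * (c - a)) * (e - psiPot φ ℓ (a + θ * (c - a))) := by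
  have := (h.convPsi hℓ).2 (show a ∈ Ioi 0 from ha) (show c ∈ Ioi 0 from hc)
    (sub_nonneg.2 h1) h0 (by ring)
  simp only [smul_eq_mul] at this
  rw [show (1 - θ) * a + θ * c = a + θ * (c - a) by ring] at this
  have h2 : θ * c * (psiPot φ ℓ c - e) ≤ 0 :=
    mul_nonpos_of_nonneg_of_nonpos (by positivity) (by linarith)
  linarith

lemma pos_seg {a c θ : ℝ} (ha : 0 < a) (hc : 0 < c) (h0 : 0 ≤ θ) (h1 : θ ≤ 1) :
    0 < a + θ * (c - a) := by
  have := (convex_Ioi (0:ℝ)) (show a ∈ Ioi 0 from ha) (show c ∈ Ioi 0 from hc)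
    (sub_nonneg.2 h1) h0 (by ring)
  simp only [smul_eq_mul] at this
  have h2 : 0 < (1 - θ) * a + θ * c := this
  linarith

lemma GoodPot.seg_lt {φ : ℝ → ℝ} (h : GoodPot φ) {ℓ : ℝ} (hℓ : 0 < ℓ) {a c θ e : ℝ}
    (ha : 0 < a) (hc : 0 < c) (h0 : 0 ≤ θ) (h1 : θ < 1) (hae : psiPot φ ℓ a < e)
    (hce : psiPot φ ℓ c ≤ e) : psiPot φ ℓ (a + θ * (c - a)) < e := by
  have h2 := h.chord hℓ ha hc h0 h1.le hce
  have h3 := pos_seg ha hc h0 h1.le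
  have h4 : 0 < (1 - θ) * a * (e - psiPot φ ℓ a) :=
    mul_pos (mul_pos (by linarith) ha) (by linarith)
  by_contra! h5
  have := mul_nonpos_of_nonneg_of_nonpos h3.le (sub_nonpos.2 h5)
  linarith

lemma GoodPot.btw_lt {φ : ℝ → ℝ} (h : GoodPot φ) {ℓ : ℝ} (hℓ : 0 < ℓ) {a c r e : ℝ}
    (ha : 0 < a) (hc : 0 < c) (hae : psiPot φ ℓ a < e) (hce : psiPot φ ℓ c ≤ e)
    (hr : (a ≤ r ∧ r < c) ∨ (c < r ∧ r ≤ a)) : psiPot φ ℓ r < e := by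
  have hca : c - a ≠ 0 := by rcases hr with hr | hr <;> intro h <;> linarith [hr.1, hr.2]
  have e1 : r = a + ((r - a) / (c - a)) * (c - a) := by field_simp; ring
  rw [e1]
  apply h.seg_lt hℓ ha hc _ _ hae hce
  · rcases hr with hr | hr
    · exact div_nonneg (by linarith) (by linarith)
    · exact div_nonneg_of_nonpos (by linarith) (by linarith)
  · rcases hr with hr | hr
    · rw [div_lt_one (by linarith)]; linarith
    · rw [div_lt_one_of_neg (by linarith)]; linarith

/-- right endpoints -/
lemma GoodPot.endR {φ : ℝ → ℝ} (h : GoodPot φ) {ℓ : ℝ} (hℓ : 0 < ℓ) {a e : ℝ}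
    (ha : 0 < a) (hae : psiPot φ ℓ a < e) (he : e < 0) :
    ∃ c, a < c ∧ psiPot φ ℓ c = e := by
  obtain ⟨α, β, hα, hαβ, h1, h2⟩ := h.lowPsi hℓ he
  have haβ : a < β := by
    by_contra! hh; linarith [h2 a hh]
  have hcont : ContinuousOn (psiPot φ ℓ) (Icc a β) :=
    (h.contPsi ℓ).mono fun x hx => lt_of_lt_of_le ha hx.1
  obtain ⟨c, hc, hce⟩ := intermediate_value_Icc haβ.le hcont ⟨hae.le, (h2 β le_rfl).le⟩
  refine ⟨c, lt_of_le_of_ne hc.1 ?_, hce⟩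
  rintro rfl; linarith

lemma GoodPot.endL {φ : ℝ → ℝ} (h : GoodPot φ) {ℓ : ℝ} (hℓ : 0 < ℓ) {a e : ℝ}
    (ha : 0 < a) (hae : psiPot φ ℓ a < e) (he : e < 0) :
    ∃ c, 0 < c ∧ c < a ∧ psiPot φ ℓ c = e := by
  obtain ⟨α, β, hα, hαβ, h1, h2⟩ := h.lowPsi hℓ he
  have haα : α < a := by
    by_contra! hh; linarith [h1 a ha hh]
  have hcont : ContinuousOn (psiPot φ ℓ) (Icc α a) :=
    (h.contPsi ℓ).mono fun x hx => lt_of_lt_of_le hα hx.1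
  obtain ⟨c, hc, hce⟩ := intermediate_value_Icc' haα.le hcont ⟨hae.le, (h1 α hα le_rfl).le⟩
  refine ⟨c, hα.trans_le hc.1, lt_of_le_of_ne hc.2 ?_, hce⟩
  rintro rfl; linarith

/-- integrand of the Jacobian -/
lemma GoodPot.integr {φ : ℝ → ℝ} (h : GoodPot φ) {ℓ : ℝ} (hℓ : 0 < ℓ) {e : ℝ} (he : e < 0) :
    IntegrableOn (fun r => √(e - psiPot φ ℓ r)) (Ioi 0) := by
  obtain ⟨α, β, hα, hαβ, h1, h2⟩ := h.lowPsi hℓ he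
  have hc : ContinuousOn (fun r => √(e - psiPot φ ℓ r)) (Icc α β) :=
    (continuousOn_const.sub ((h.contPsi ℓ).mono fun x hx => lt_of_lt_of_le hα hx.1)).sqrt
  refine (hc.integrableOn_compact isCompact_Icc).of_forall_sdiff_eq_zero measurableSet_Ioi ?_
  intro r hr
  apply Real.sqrt_eq_zero_of_nonpos
  have hr0 : 0 < r := hr.1
  by_cases hh : r ≤ α
  · linarith [h1 r hr0 hh]
  · have : β ≤ r := by
      by_contra hb; exact hr.2 ⟨by linarith, by linarith⟩
    linarith [h2 r this]

lemma sqrt_max (x : ℝ) : √(max x 0) = √x := by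
  rcases le_total x 0 with h | h
  · rw [max_eq_right h, Real.sqrt_zero, Real.sqrt_eq_zero_of_nonpos h]
  · rw [max_eq_left h]

lemma aPot_eq (φ : ℝ → ℝ) (e ℓ : ℝ) :
    aPot φ e ℓ = 8 * π ^ 2 * √2 * ∫ r in Ioi (0:ℝ), √(e - psiPot φ ℓ r) := by
  unfold aPot; simp_rw [sqrt_max]

lemma aPot_nonneg (φ : ℝ → ℝ) (e ℓ : ℝ) : 0 ≤ aPot φ e ℓ := by
  rw [aPot_eq]
  exact mul_nonneg (by positivity) (integral_nonneg fun _ => Real.sqrt_nonneg _)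

lemma GoodPot.aMono {φ : ℝ → ℝ} (h : GoodPot φ) {ℓ : ℝ} (hℓ : 0 < ℓ) {e e' : ℝ} (hee : e ≤ e')
    (he : e' < 0) : aPot φ e ℓ ≤ aPot φ e' ℓ := by
  rw [aPot_eq, aPot_eq]
  refine mul_le_mul_of_nonneg_left ?_ (by positivity)
  refine setIntegral_mono_on (h.integr hℓ (by linarith)) (h.integr hℓ he) measurableSet_Ioi ?_
  intro r _
  exact Real.sqrt_le_sqrt (by linarith)

lemma GoodPot.aStrict {φ : ℝ → ℝ} (h : GoodPot φ) {ℓ : ℝ} (hℓ : 0 < ℓ) {e e' : ℝ} (hee : e < e')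
    (he : e' < 0) (hm : eMinPot φ ℓ ≤ e) : aPot φ e ℓ < aPot φ e' ℓ := by
  rw [aPot_eq, aPot_eq]
  refine mul_lt_mul_of_pos_left ?_ (by positivity)
  have i1 := h.integr hℓ (hee.trans he)
  have i2 := h.integr hℓ he
  have i3 : IntegrableOn (fun r => √(e' - psiPot φ ℓ r) - √(e - psiPot φ ℓ r)) (Ioi 0) := i2.sub i1
  rw [← sub_pos, ← integral_sub i2 i1, setIntegral_pos_iff_support_of_nonneg_ae _ i3]
  · obtain ⟨_, ⟨a, ha, rfl⟩, hae⟩ := exists_lt_of_csInf_lt (by simp) (lt_of_le_of_lt hm hee)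
    have ha : 0 < a := ha
    have hop : IsOpen (Ioi 0 ∩ (psiPot φ ℓ) ⁻¹' (Iio e')) :=
      (h.contPsi ℓ).isOpen_inter_preimage isOpen_Ioi isOpen_Iio
    refine lt_of_lt_of_le (hop.measure_pos volume ⟨a, ha, hae⟩) (measure_mono ?_)
    rintro r ⟨hr, hre⟩
    refine ⟨?_, hr⟩
    have hre : psiPot φ ℓ r < e' := hre
    rw [Function.mem_support]
    have := Real.sqrt_lt_sqrt_iff_of_pos (x := e - psiPot φ ℓ r) (y := e' - psiPot φ ℓ r) (by linarith)
    have := this.2 (by linarith)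
    linarith
  · refine ae_of_all _ fun r => ?_
    have := Real.sqrt_le_sqrt (show e - psiPot φ ℓ r ≤ e' - psiPot φ ℓ r by linarith)
    simp only [Pi.zero_apply]; linarith

lemma inv_sqrt_rpow (x : ℝ) : (√x)⁻¹ = x ^ (-1/2 : ℝ) := by
  rcases lt_or_ge x 0 with h | h
  · rw [Real.sqrt_eq_zero_of_nonpos h.le, inv_zero, Real.rpow_def_of_neg h,
      show (-1/2 : ℝ) * π = -(π / 2) by ring, cos_neg, cos_pi_div_two, mul_zero]
  · rw [Real.sqrt_eq_rpow, ← Real.rpow_neg h]; norm_num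

lemma ii_inv_sqrt (p a b : ℝ) : IntervalIntegrable (fun τ => (√(τ - p))⁻¹) volume a b := by
  simp_rw [inv_sqrt_rpow]
  have := (intervalIntegral.intervalIntegrable_rpow' (a := a - p) (b := b - p)
    (show (-1:ℝ) < -1/2 by norm_num)).comp_sub_right p
  simpa using this

lemma ii_inv_sqrt' (a b : ℝ) : IntervalIntegrable (fun τ => (√(1 - τ))⁻¹) volume a b := by
  simp_rw [inv_sqrt_rpow]
  have := (intervalIntegral.intervalIntegrable_rpow' (a := 1 - a) (b := 1 - b)
    (show (-1:ℝ) < -1/2 by norm_num)).comp_sub_left 1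
  simpa using this

lemma int_inv_sqrt (p a b : ℝ) :
    ∫ τ in a..b, (√(τ - p))⁻¹ = 2 * (√(b - p) - √(a - p)) := by
  simp_rw [inv_sqrt_rpow]
  rw [intervalIntegral.integral_comp_sub_right (fun x => x ^ (-1/2 : ℝ)) p, integral_rpow (by norm_num)]
  rw [Real.sqrt_eq_rpow, Real.sqrt_eq_rpow]
  norm_num
  ring

lemma GoodPot.pt {φ : ℝ → ℝ} (h : GoodPot φ) {ℓ : ℝ} (hℓ : 0 < ℓ) {a c e κ θ : ℝ}
    (ha : 0 < a) (hc : 0 < c) (hce : psiPot φ ℓ c = e) (hκ : 0 < κ)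
    (hk : κ * (a + c) ≤ a * (e - psiPot φ ℓ a))
    (h0 : 0 ≤ θ) (h1 : θ < 1) :
    ‖(√(e - psiPot φ ℓ (a + (c - a) * θ)))⁻¹‖ ≤ (√κ)⁻¹ * (√(1 - θ))⁻¹ := by
  rw [mul_comm (c - a)]
  have h2 := h.chord hℓ ha hc h0 h1.le hce.le
  have h3 := pos_seg ha hc h0 h1.le
  have h4 : a + θ * (c - a) ≤ a + c := by nlinarith
  have h5 : (1 - θ) * κ ≤ e - psiPot φ ℓ (a + θ * (c - a)) := by
    have h6 : (1 - θ) * κ * (a + θ * (c - a)) ≤ (1 - θ) * κ * (a + c) :=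
      mul_le_mul_of_nonneg_left h4 (mul_nonneg (by linarith) hκ.le)
    have h7 : (1 - θ) * (κ * (a + c)) ≤ (1 - θ) * (a * (e - psiPot φ ℓ a)) :=
      mul_le_mul_of_nonneg_left hk (by linarith)
    refine le_of_mul_le_mul_left ?_ h3
    linarith
  rw [Real.norm_of_nonneg (by positivity), ← mul_inv, ← Real.sqrt_mul hκ.le]
  have h8 : 0 < κ * (1 - θ) := mul_pos hκ (by linarith)
  exact inv_anti₀ (Real.sqrt_pos.2 h8) (Real.sqrt_le_sqrt (by linarith))

lemma GoodPot.meas {φ : ℝ → ℝ} (h : GoodPot φ) {ℓ : ℝ} {a c e : ℝ}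
    (ha : 0 < a) (hc : 0 < c) :
    AEStronglyMeasurable (fun θ => (√(e - psiPot φ ℓ (a + (c - a) * θ)))⁻¹)
      (volume.restrict (uIoc 0 1)) := by
  rw [uIoc_of_le zero_le_one]
  have h1 : ContinuousOn (fun θ => √(e - psiPot φ ℓ (a + (c - a) * θ))) (Ioc 0 1) := by
    refine (continuousOn_const.sub ((h.contPsi ℓ).comp (t := Ioi 0) (f := fun θ => a + (c - a) * θ) (by fun_prop) ?_)).sqrt
    intro θ hθ
    have := pos_seg ha hc hθ.1.le hθ.2
    show 0 < a + (c - a) * θ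
    linarith
  exact ((h1.aestronglyMeasurable measurableSet_Ioc).aemeasurable.inv).aestronglyMeasurable

lemma ae_theta (P : ℝ → Prop) (h : ∀ θ, 0 < θ → θ < 1 → P θ) :
    ∀ᵐ θ : ℝ, θ ∈ uIoc (0:ℝ) 1 → P θ := by
  have : ∀ᵐ θ : ℝ, θ ≠ 1 := by
    simp [ae_iff, measure_singleton]
  filter_upwards [this] with θ hθ hm
  rw [uIoc_of_le zero_le_one] at hm
  exact h θ hm.1 (lt_of_le_of_ne hm.2 hθ)

lemma GoodPot.ii {φ : ℝ → ℝ} (h : GoodPot φ) {ℓ : ℝ} (hℓ : 0 < ℓ) {a c e : ℝ}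
    (ha : 0 < a) (hc : 0 < c) (hae : psiPot φ ℓ a < e) (hce : psiPot φ ℓ c = e) :
    IntervalIntegrable (fun θ => (√(e - psiPot φ ℓ (a + (c - a) * θ)))⁻¹) volume 0 1 := by
  have hκ : 0 < a * (e - psiPot φ ℓ a) / (a + c) := div_pos (mul_pos ha (by linarith)) (by linarith)
  refine ((ii_inv_sqrt' 0 1).const_mul (√(a * (e - psiPot φ ℓ a) / (a + c)))⁻¹).mono_fun (h.meas ha hc) ?_
  refine (ae_restrict_iff' measurableSet_uIoc).2 (ae_theta _ fun θ h0 h1 => ?_)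
  refine (h.pt hℓ ha hc hce hκ ?_ h0.le h1).trans (le_abs_self _)
  rw [div_mul_cancel₀]; positivity

lemma GoodPot.posJ {φ : ℝ → ℝ} (h : GoodPot φ) {ℓ : ℝ} (hℓ : 0 < ℓ) {a c e : ℝ}
    (ha : 0 < a) (hc : 0 < c) (hae : psiPot φ ℓ a < e) (hce : psiPot φ ℓ c = e) :
    0 < ∫ θ in (0:ℝ)..1, (√(e - psiPot φ ℓ (a + (c - a) * θ)))⁻¹ := by
  refine intervalIntegral.intervalIntegral_pos_of_pos_on (h.ii hℓ ha hc hae hce) ?_ one_pos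
  intro θ hθ
  have := h.seg_lt hℓ ha hc hθ.1.le hθ.2 hae hce.le
  rw [mul_comm (c - a)]
  exact inv_pos.2 (Real.sqrt_pos.2 (by linarith))

lemma scaleJ (f : ℝ → ℝ) (a c : ℝ) :
    ∫ r in a..c, f r = (c - a) * ∫ θ in (0:ℝ)..1, f (a + (c - a) * θ) := by
  have := intervalIntegral.smul_integral_comp_add_mul (a := 0) (b := 1) f (c - a) a
  rw [smul_eq_mul] at this
  rw [this]; simp

lemma GoodPot.contB {φ : ℝ → ℝ} (h : GoodPot φ) {ℓ : ℝ} (hℓ : 0 < ℓ) {a : ℝ}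
    (ha : 0 < a) (c : ℝ → ℝ) (hc : ∀ e ∈ Ioo (psiPot φ ℓ a) 0, 0 < c e)
    (hce : ∀ e ∈ Ioo (psiPot φ ℓ a) 0, psiPot φ ℓ (c e) = e)
    (hcc : ContinuousOn c (Ioo (psiPot φ ℓ a) 0)) :
    ContinuousOn (fun e => ∫ r in a..c e, (√(e - psiPot φ ℓ r))⁻¹) (Ioo (psiPot φ ℓ a) 0) := by
  intro e he
  apply ContinuousAt.continuousWithinAt
  have hnh : Ioo (psiPot φ ℓ a) 0 ∈ 𝓝 e := isOpen_Ioo.mem_nhds he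
  have hca : ContinuousAt c e := hcc.continuousAt hnh
  have : (fun e => ∫ r in a..c e, (√(e - psiPot φ ℓ r))⁻¹) =
    fun e => (c e - a) * ∫ θ in (0:ℝ)..1, (√(e - psiPot φ ℓ (a + (c e - a) * θ)))⁻¹ := by
    ext e; exact scaleJ (fun r => (√(e - psiPot φ ℓ r))⁻¹) a (c e)
  rw [this]
  refine (hca.sub continuousAt_const).mul ?_
  have hc0 := hc e he
  set κ := a * ((e - psiPot φ ℓ a) / 2) / (a + c e + 1) with hκd
  have hpos : 0 < e - psiPot φ ℓ a := by linarith [he.1]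
  have hκ : 0 < κ := by positivity
  refine intervalIntegral.continuousAt_of_dominated_interval
    (bound := fun θ => (√κ)⁻¹ * (√(1 - θ))⁻¹) ?_ ?_ ((ii_inv_sqrt' 0 1).const_mul _) ?_
  · filter_upwards [hnh] with e' he'
    exact h.meas ha (hc e' he')
  · have h1 : ∀ᶠ e' in 𝓝 e, c e' < c e + 1 := hca.eventually_lt continuousAt_const (by linarith)
    have h2 : ∀ᶠ e' in 𝓝 e, (e + psiPot φ ℓ a) / 2 < e' := eventually_gt_nhds (by linarith)
    filter_upwards [hnh, h1, h2] with e' he' h1 h2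
    refine ae_theta _ fun θ h3 h4 => h.pt hℓ ha (hc e' he') (hce e' he') hκ ?_ h3.le h4
    calc κ * (a + c e') ≤ κ * (a + c e + 1) := mul_le_mul_of_nonneg_left (by linarith) hκ.le
      _ = a * ((e - psiPot φ ℓ a) / 2) := by rw [hκd]; field_simp
      _ ≤ _ := mul_le_mul_of_nonneg_left (by linarith) ha.le
  · refine ae_theta _ fun θ h3 h4 => ?_
    have h5 := pos_seg ha hc0 h3.le h4.le
    have h6 := h.seg_lt hℓ ha hc0 h3.le h4 he.1 (hce e he).le
    rw [mul_comm θ] at h5 h6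
    have h7 : ContinuousAt (fun e' => psiPot φ ℓ (a + (c e' - a) * θ)) e := by
      refine ContinuousAt.comp (f := fun e' => a + (c e' - a) * θ) (g := psiPot φ ℓ) ?_ (by fun_prop)
      exact (h.contPsi ℓ).continuousAt (isOpen_Ioi.mem_nhds h5)
    refine (continuousAt_id.sub h7).sqrt.inv₀ ?_
    exact (Real.sqrt_pos.2 (by simpa using h6)).ne'

lemma GoodPot.tonelli {φ : ℝ → ℝ} (h : GoodPot φ) {ℓ : ℝ} (hℓ : 0 < ℓ) {S : Set ℝ}
    (hS : MeasurableSet S) (hS0 : S ⊆ Ioi 0) {e1 e2 : ℝ} (h12 : e1 ≤ e2) (h2 : e2 < 0) :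
    (∫ r in S, √(e2 - psiPot φ ℓ r)) = (∫ r in S, √(e1 - psiPot φ ℓ r)) +
      ∫ τ in e1..e2, (1 / 2) * ∫ r in S, (√(τ - psiPot φ ℓ r))⁻¹ := by
  have i1 := (h.integr hℓ (lt_of_le_of_lt h12 h2)).mono_set hS0
  have i2 := (h.integr hℓ h2).mono_set hS0
  have hm : AEMeasurable (psiPot φ ℓ) (volume.restrict S) :=
    (((h.contPsi ℓ).mono hS0).aestronglyMeasurable hS).aemeasurable
  have hm2 : AEStronglyMeasurable (Function.uncurry fun τ r => (√(τ - psiPot φ ℓ r))⁻¹)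
      ((volume.restrict (Ioc e1 e2)).prod (volume.restrict S)) := by
    have hsnd : AEMeasurable (fun p : ℝ × ℝ => psiPot φ ℓ p.2)
      ((volume.restrict (Ioc e1 e2)).prod (volume.restrict S)) :=
      hm.comp_quasiMeasurePreserving Measure.quasiMeasurePreserving_snd
    have : AEMeasurable (fun p : ℝ × ℝ => (√(p.1 - psiPot φ ℓ p.2))⁻¹)
      ((volume.restrict (Ioc e1 e2)).prod (volume.restrict S)) :=
      ((measurable_fst.aemeasurable.sub hsnd).sqrt).inv
    exact this.aestronglyMeasurable
  have hslice : ∀ r, ∫ τ in Ioc e1 e2, (√(τ - psiPot φ ℓ r))⁻¹ =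
      2 * (√(e2 - psiPot φ ℓ r) - √(e1 - psiPot φ ℓ r)) := fun r => by
    rw [← intervalIntegral.integral_of_le h12, int_inv_sqrt]
  have hi : Integrable (Function.uncurry fun τ r => (√(τ - psiPot φ ℓ r))⁻¹)
      ((volume.restrict (Ioc e1 e2)).prod (volume.restrict S)) := by
    rw [integrable_prod_iff' hm2]
    constructor
    · refine ae_of_all _ fun r => ?_
      exact (intervalIntegrable_iff_integrableOn_Ioc_of_le h12).1 (ii_inv_sqrt (psiPot φ ℓ r) e1 e2)
    · have : ∀ r τ : ℝ, ‖Function.uncurry (fun τ r => (√(τ - psiPot φ ℓ r))⁻¹) (τ, r)‖ = (√(τ - psiPot φ ℓ r))⁻¹ :=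
        fun r τ => Real.norm_of_nonneg (by simp only [Function.uncurry]; positivity)
      simp_rw [this, hslice]
      exact (i2.sub i1).const_mul 2
  have hsw := integral_integral_swap hi
  rw [intervalIntegral.integral_const_mul, intervalIntegral.integral_of_le h12, hsw]
  simp_rw [hslice]
  rw [integral_const_mul, integral_sub i2 i1]
  ring

lemma GoodPot.derivS {φ : ℝ → ℝ} (h : GoodPot φ) {ℓ : ℝ} (hℓ : 0 < ℓ) {S : Set ℝ}
    (hS : MeasurableSet S) (hS0 : S ⊆ Ioi 0) {m : ℝ}
    (hb : ContinuousOn (fun τ => ∫ r in S, (√(τ - psiPot φ ℓ r))⁻¹) (Ioo m 0)) {e : ℝ}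
    (he : e ∈ Ioo m 0) :
    HasDerivAt (fun e => ∫ r in S, √(e - psiPot φ ℓ r))
      ((1 / 2) * ∫ r in S, (√(e - psiPot φ ℓ r))⁻¹) e := by
  obtain ⟨e1, h1, h2⟩ := exists_between he.1
  have hb' : ContinuousOn (fun τ => (1 / 2) * ∫ r in S, (√(τ - psiPot φ ℓ r))⁻¹) (Ioo m 0) :=
    continuousOn_const.mul hb
  have key : HasDerivAt (fun e => (∫ r in S, √(e1 - psiPot φ ℓ r)) +
      ∫ τ in e1..e, (1 / 2) * ∫ r in S, (√(τ - psiPot φ ℓ r))⁻¹)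
      ((1 / 2) * ∫ r in S, (√(e - psiPot φ ℓ r))⁻¹) e := by
    refine HasDerivAt.const_add _ ?_
    refine intervalIntegral.integral_hasDerivAt_right ?_ ?_ (hb'.continuousAt (isOpen_Ioo.mem_nhds he))
    · refine (hb'.mono ?_).intervalIntegrable
      rw [uIcc_of_le h2.le]
      exact fun x hx => ⟨h1.trans_le hx.1, hx.2.trans_lt he.2⟩
    · exact hb'.stronglyMeasurableAtFilter isOpen_Ioo e he
  refine key.congr_of_eventuallyEq ?_
  filter_upwards [isOpen_Ioo.mem_nhds (show e ∈ Ioo e1 0 from ⟨h2, he.2⟩)] with x hx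
  exact h.tonelli hℓ hS hS0 hx.1.le hx.2

lemma GoodPot.endpts {φ : ℝ → ℝ} (h : GoodPot φ) {ℓ : ℝ} (hℓ : 0 < ℓ) {a : ℝ} (ha : 0 < a) :
    ∃ cL cR : ℝ → ℝ, (∀ e ∈ Ioo (psiPot φ ℓ a) 0, 0 < cL e ∧ cL e < a ∧ psiPot φ ℓ (cL e) = e) ∧
      (∀ e ∈ Ioo (psiPot φ ℓ a) 0, a < cR e ∧ psiPot φ ℓ (cR e) = e) ∧
      ContinuousOn cL (Ioo (psiPot φ ℓ a) 0) ∧ ContinuousOn cR (Ioo (psiPot φ ℓ a) 0) := by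
  have hL : ∀ e : ℝ, ∃ c, e ∈ Ioo (psiPot φ ℓ a) 0 → 0 < c ∧ c < a ∧ psiPot φ ℓ c = e := by
    intro e
    by_cases he : e ∈ Ioo (psiPot φ ℓ a) 0
    · obtain ⟨c, hc⟩ := h.endL hℓ ha he.1 he.2
      exact ⟨c, fun _ => hc⟩
    · exact ⟨0, fun h' => absurd h' he⟩
  have hR : ∀ e : ℝ, ∃ c, e ∈ Ioo (psiPot φ ℓ a) 0 → a < c ∧ psiPot φ ℓ c = e := by
    intro e
    by_cases he : e ∈ Ioo (psiPot φ ℓ a) 0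
    · obtain ⟨c, hc⟩ := h.endR hℓ ha he.1 he.2
      exact ⟨c, fun _ => hc⟩
    · exact ⟨0, fun h' => absurd h' he⟩
  choose cL hL using hL
  choose cR hR using hR
  refine ⟨cL, cR, hL, hR, ?_, ?_⟩
  · intro e he
    apply ContinuousAt.continuousWithinAt
    have hnh : Ioo (psiPot φ ℓ a) 0 ∈ 𝓝 e := isOpen_Ioo.mem_nhds he
    obtain ⟨h1, h2, h3⟩ := hL e he
    refine tendsto_order.2 ⟨fun x hx => ?_, fun x hx => ?_⟩
    · by_cases hx0 : x ≤ 0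
      · filter_upwards [hnh] with e' he'
        exact hx0.trans_lt (hL e' he').1
      push Not at hx0
      have hx1 : e < psiPot φ ℓ x := by
        by_contra! hh
        have := h.btw_lt hℓ ha hx0 he.1 hh (r := cL e) (Or.inr ⟨hx, h2.le⟩)
        linarith
      filter_upwards [hnh, eventually_lt_nhds hx1] with e' he' hlt
      obtain ⟨h1', h2', h3'⟩ := hL e' he'
      by_contra! hh
      rcases hh.lt_or_eq with hh | hh
      · have := h.btw_lt hℓ ha h1' he'.1 h3'.le (r := x) (Or.inr ⟨hh, by linarith⟩)
        linarith
      · rw [hh] at h3'; linarith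
    · obtain ⟨y, hy1, hy2⟩ := exists_between (lt_min hx h2)
      have hyx := hy2.trans_le (min_le_left _ _)
      have hya := hy2.trans_le (min_le_right _ _)
      have hy : psiPot φ ℓ y < e := h.btw_lt hℓ ha h1 he.1 h3.le (Or.inr ⟨hy1, hya.le⟩)
      filter_upwards [hnh, eventually_gt_nhds hy] with e' he' hlt
      obtain ⟨h1', h2', h3'⟩ := hL e' he'
      by_contra! hh
      have := h.btw_lt hℓ ha (h1.trans hy1) he'.1 hlt.le (r := cL e') (Or.inr ⟨by linarith, h2'.le⟩)
      linarith
  · intro e he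
    apply ContinuousAt.continuousWithinAt
    have hnh : Ioo (psiPot φ ℓ a) 0 ∈ 𝓝 e := isOpen_Ioo.mem_nhds he
    obtain ⟨h2, h3⟩ := hR e he
    refine tendsto_order.2 ⟨fun x hx => ?_, fun x hx => ?_⟩
    · obtain ⟨y, hy1, hy2⟩ := exists_between (max_lt hx h2)
      have hyx := (le_max_left _ _).trans_lt hy1
      have hya := (le_max_right _ _).trans_lt hy1
      have hy : psiPot φ ℓ y < e := h.btw_lt hℓ ha (ha.trans h2) he.1 h3.le (Or.inl ⟨hya.le, hy2⟩)
      filter_upwards [hnh, eventually_gt_nhds hy] with e' he' hlt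
      obtain ⟨h2', h3'⟩ := hR e' he'
      by_contra! hh
      have := h.btw_lt hℓ ha (ha.trans hya) he'.1 hlt.le (r := cR e') (Or.inl ⟨h2'.le, by linarith⟩)
      linarith
    · have hx0 : 0 < x := by linarith
      have hx1 : e < psiPot φ ℓ x := by
        by_contra! hh
        have := h.btw_lt hℓ ha hx0 he.1 hh (r := cR e) (Or.inl ⟨h2.le, hx⟩)
        linarith
      filter_upwards [hnh, eventually_lt_nhds hx1] with e' he' hlt
      obtain ⟨h2', h3'⟩ := hR e' he'
      by_contra! hh
      rcases hh.lt_or_eq with hh | hh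
      · have := h.btw_lt hℓ ha (ha.trans h2') he'.1 h3'.le (r := x) (Or.inl ⟨by linarith, hh⟩)
        linarith
      · rw [← hh] at h3'; linarith

lemma GoodPot.aDeriv {φ : ℝ → ℝ} (h : GoodPot φ) {ℓ : ℝ} (hℓ : 0 < ℓ) {a : ℝ} (ha : 0 < a) :
    ∃ b : ℝ → ℝ, ContinuousOn b (Ioo (psiPot φ ℓ a) 0) ∧ ∀ e ∈ Ioo (psiPot φ ℓ a) 0,
      0 < b e ∧ HasDerivAt (fun e => aPot φ e ℓ) (b e) e := by
  obtain ⟨cL, cR, hL, hR, hLc, hRc⟩ := h.endpts hℓ ha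
  set I := Ioo (psiPot φ ℓ a) 0 with hI
  have hzero : ∀ e r, e ≤ psiPot φ ℓ r → (√(e - psiPot φ ℓ r))⁻¹ = 0 := fun e r her => by
    rw [Real.sqrt_eq_zero_of_nonpos (by linarith), inv_zero]
  have eR : ∀ e ∈ I, ∫ r in Ioi a, (√(e - psiPot φ ℓ r))⁻¹ = ∫ r in a..cR e, (√(e - psiPot φ ℓ r))⁻¹ := by
    intro e he
    obtain ⟨h2, h3⟩ := hR e he
    rw [intervalIntegral.integral_of_le h2.le]
    refine setIntegral_eq_of_subset_of_forall_sdiff_eq_zero measurableSet_Ioi (fun x hx => hx.1) ?_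
    intro r hr
    have hra : a < r := hr.1
    have hrc : cR e < r := by
      by_contra! hh; exact hr.2 ⟨hra, hh⟩
    apply hzero
    by_contra! hh
    have := h.btw_lt hℓ ha (ha.trans hra) he.1 hh.le (r := cR e) (Or.inl ⟨h2.le, hrc⟩)
    linarith
  have eL : ∀ e ∈ I, ∫ r in Ioc 0 a, (√(e - psiPot φ ℓ r))⁻¹ = -∫ r in a..cL e, (√(e - psiPot φ ℓ r))⁻¹ := by
    intro e he
    obtain ⟨h1, h2, h3⟩ := hL e he
    rw [← intervalIntegral.integral_symm, intervalIntegral.integral_of_le h2.le]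
    refine setIntegral_eq_of_subset_of_forall_sdiff_eq_zero measurableSet_Ioc
      (fun x hx => ⟨h1.trans hx.1, hx.2⟩) ?_
    intro r hr
    have hra : r ≤ a := hr.1.2
    have hr0 : 0 < r := hr.1.1
    have hrc : r ≤ cL e := by
      by_contra! hh; exact hr.2 ⟨hh, hra⟩
    apply hzero
    by_contra! hh
    rcases hrc.lt_or_eq with hrc | hrc
    · have := h.btw_lt hℓ ha hr0 he.1 hh.le (r := cL e) (Or.inr ⟨hrc, h2.le⟩)
      linarith
    · rw [hrc] at hh; linarith
  have cR' : ContinuousOn (fun e => ∫ r in Ioi a, (√(e - psiPot φ ℓ r))⁻¹) I :=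
    (h.contB hℓ ha cR (fun e he => ha.trans (hR e he).1) (fun e he => (hR e he).2) hRc).congr eR
  have cL' : ContinuousOn (fun e => ∫ r in Ioc 0 a, (√(e - psiPot φ ℓ r))⁻¹) I :=
    (h.contB hℓ ha cL (fun e he => (hL e he).1) (fun e he => (hL e he).2.2) hLc).neg.congr eL
  refine ⟨fun e => 8 * π ^ 2 * √2 * ((1 / 2) * (∫ r in Ioc 0 a, (√(e - psiPot φ ℓ r))⁻¹) +
    (1 / 2) * ∫ r in Ioi a, (√(e - psiPot φ ℓ r))⁻¹), ?_, fun e he => ⟨?_, ?_⟩⟩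
  · exact continuousOn_const.mul ((continuousOn_const.mul cL').add (continuousOn_const.mul cR'))
  · have p1 : 0 ≤ ∫ r in Ioc 0 a, (√(e - psiPot φ ℓ r))⁻¹ :=
      integral_nonneg fun r => by simp only [Pi.zero_apply]; positivity
    have p2 : 0 < ∫ r in Ioi a, (√(e - psiPot φ ℓ r))⁻¹ := by
      obtain ⟨h2, h3⟩ := hR e he
      rw [eR e he, scaleJ]
      exact mul_pos (by linarith) (h.posJ hℓ ha (ha.trans h2) he.1 h3)
    positivity
  · have d1 := h.derivS hℓ (S := Ioc 0 a) measurableSet_Ioc (fun x hx => hx.1) cL' he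
    have d2 := h.derivS hℓ (S := Ioi a) measurableSet_Ioi (fun x hx => ha.trans hx) cR' he
    refine ((d1.add d2).const_mul (8 * π ^ 2 * √2)).congr_of_eventuallyEq ?_
    filter_upwards [isOpen_Ioo.mem_nhds he] with x hx
    rw [aPot_eq]
    have hu : Ioi (0:ℝ) = Ioc 0 a ∪ Ioi a := (Ioc_union_Ioi_eq_Ioi ha.le).symm
    have i := h.integr hℓ hx.2
    rw [hu] at i ⊢
    rw [setIntegral_union (Ioc_disjoint_Ioi le_rfl) measurableSet_Ioi i.left_of_union i.right_of_union]
    rfl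

lemma GoodPot.aC1 {φ : ℝ → ℝ} (h : GoodPot φ) {ℓ : ℝ} (hℓ : 0 < ℓ) {e : ℝ}
    (hm : eMinPot φ ℓ < e) (he : e < 0) :
    ContDiffAt ℝ 1 (fun e => aPot φ e ℓ) e ∧
      ∃ d, d ≠ 0 ∧ HasDerivAt (fun e => aPot φ e ℓ) d e := by
  obtain ⟨_, ⟨a, ha, rfl⟩, hae⟩ := exists_lt_of_csInf_lt (by simp) hm
  have ha : 0 < a := ha
  obtain ⟨b, hbc, hb⟩ := h.aDeriv hℓ ha
  refine ⟨?_, b e, (hb e ⟨hae, he⟩).1.ne', (hb e ⟨hae, he⟩).2⟩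
  have : ContDiffOn ℝ (0 + 1) (fun e => aPot φ e ℓ) (Ioo (psiPot φ ℓ a) 0) := by
    rw [contDiffOn_succ_iff_deriv_of_isOpen isOpen_Ioo]
    refine ⟨fun x hx => (hb x hx).2.differentiableAt.differentiableWithinAt, by simp, ?_⟩
    rw [contDiffOn_zero]
    exact hbc.congr fun x hx => (hb x hx).2.deriv
  rw [zero_add] at this
  exact this.contDiffAt (isOpen_Ioo.mem_nhds ⟨hae, he⟩)

lemma innerPos {r ℓ α β : ℝ} (hr : 0 < r) (hℓ : 0 < ℓ) (hα : 0 < α) (hα2 : r ^ 2 * α ^ 2 = ℓ) (hab : α ≤ β) :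
    ∫⁻ u in Ioo α β, ENNReal.ofReal (4 * π ^ 2 * r * |u| / √(r ^ 2 * u ^ 2 - ℓ)) =
      ENNReal.ofReal (4 * π ^ 2 * √(r ^ 2 * β ^ 2 - ℓ) / r) := by
  set G : ℝ → ℝ := fun u => 4 * π ^ 2 * √(r ^ 2 * u ^ 2 - ℓ) / r with hG
  have hcont : ContinuousOn G (Icc α β) := by
    apply Continuous.continuousOn; fun_prop
  have hpos : ∀ u ∈ Ioo α β, 0 < r ^ 2 * u ^ 2 - ℓ := by
    intro u hu
    rw [← hα2, ← mul_sub]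
    have : α ^ 2 < u ^ 2 := pow_lt_pow_left₀ hu.1 hα.le (by norm_num)
    exact mul_pos (by positivity) (by linarith)
  have hder : ∀ u ∈ Ioo α β, HasDerivAt G (4 * π ^ 2 * r * |u| / √(r ^ 2 * u ^ 2 - ℓ)) u := by
    intro u hu
    rw [abs_of_pos (hα.trans hu.1)]
    have h1 : HasDerivAt (fun u => r ^ 2 * u ^ 2 - ℓ) (2 * r ^ 2 * u) u := by
      have := ((hasDerivAt_pow 2 u).const_mul (r ^ 2)).sub_const ℓ
      refine this.congr_deriv ?_; push_cast; ring
    have h2 := ((h1.sqrt (hpos u hu).ne').const_mul (4 * π ^ 2)).div_const r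
    refine h2.congr_deriv ?_
    have := Real.sqrt_pos.2 (hpos u hu)
    field_simp
  have hnn : ∀ u ∈ Ioo α β, 0 ≤ 4 * π ^ 2 * r * |u| / √(r ^ 2 * u ^ 2 - ℓ) := fun u hu => by positivity
  have hint : IntegrableOn (fun u => 4 * π ^ 2 * r * |u| / √(r ^ 2 * u ^ 2 - ℓ)) (Ioc α β) :=
    intervalIntegral.integrableOn_deriv_of_nonneg hcont hder hnn
  have hval := intervalIntegral.integral_eq_sub_of_hasDerivAt_of_le hab hcont hder
    ((intervalIntegrable_iff_integrableOn_Ioc_of_le hab).2 hint)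
  rw [intervalIntegral.integral_of_le hab, integral_Ioc_eq_integral_Ioo] at hval
  rw [← ofReal_integral_eq_lintegral_ofReal (hint.mono_set Ioo_subset_Ioc_self)
    ((ae_restrict_iff' measurableSet_Ioo).2 (ae_of_all _ hnn)), hval]
  congr 1
  simp [hG, hα2]

lemma innerU {r ℓ w : ℝ} (hr : 0 < r) (hℓ : 0 < ℓ) :
    ∫⁻ u in {u : ℝ | ℓ < r ^ 2 * u ^ 2 ∧ u ^ 2 < w},
      ENNReal.ofReal (4 * π ^ 2 * r * |u| / √(r ^ 2 * u ^ 2 - ℓ)) =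
      ENNReal.ofReal (8 * π ^ 2 * √(w - ℓ / r ^ 2)) := by
  rcases le_or_gt w (ℓ / r ^ 2) with hw | hw
  · have : {u : ℝ | ℓ < r ^ 2 * u ^ 2 ∧ u ^ 2 < w} = ∅ := by
      ext u
      simp only [mem_ofPred_eq, mem_empty_iff_false, iff_false, not_and, not_lt]
      intro h
      refine hw.trans ?_
      rw [div_le_iff₀ (by positivity)]; linarith
    rw [this, Real.sqrt_eq_zero_of_nonpos (by linarith)]
    simp
  set α := √(ℓ / r ^ 2) with hα
  set β := √w with hβ
  have hq : 0 < ℓ / r ^ 2 := by positivity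
  have hα0 : 0 < α := Real.sqrt_pos.2 hq
  have hα2 : α ^ 2 = ℓ / r ^ 2 := Real.sq_sqrt hq.le
  have hβ2 : β ^ 2 = w := Real.sq_sqrt (hq.trans hw).le
  have hab : α ≤ β := Real.sqrt_le_sqrt hw.le
  have hβ0 : 0 < β := hα0.trans_le hab
  have hS : {u : ℝ | ℓ < r ^ 2 * u ^ 2 ∧ u ^ 2 < w} = Ioo α β ∪ (Neg.neg ⁻¹' Ioo α β) := by
    ext u
    have e1 : ℓ < r ^ 2 * u ^ 2 ↔ α < |u| := by
      rw [← abs_of_pos hα0, ← sq_lt_sq, hα2, div_lt_iff₀ (by positivity), mul_comm]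
    have e2 : u ^ 2 < w ↔ |u| < β := by
      rw [← abs_of_pos hβ0, ← sq_lt_sq, hβ2]
    simp only [mem_ofPred_eq, e1, e2, mem_union, mem_Ioo, mem_preimage]
    rcases le_total 0 u with h | h
    · rw [abs_of_nonneg h]
      constructor
      · exact Or.inl
      · rintro (h' | h')
        · exact h'
        · linarith
    · rw [abs_of_nonpos h]
      constructor
      · exact Or.inr
      · rintro (h' | h')
        · linarith
        · exact h'
  have hd : Disjoint (Ioo α β) (Neg.neg ⁻¹' Ioo α β) := by
    rw [Set.disjoint_left]
    intro u hu hu'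
    simp only [mem_preimage, mem_Ioo] at hu hu'
    linarith
  have hp := innerPos (β := β) hr hℓ hα0 (by rw [hα2]; field_simp) hab
  have hn : ∫⁻ u in (Neg.neg ⁻¹' Ioo α β), ENNReal.ofReal (4 * π ^ 2 * r * |u| / √(r ^ 2 * u ^ 2 - ℓ))
      = ∫⁻ u in Ioo α β, ENNReal.ofReal (4 * π ^ 2 * r * |u| / √(r ^ 2 * u ^ 2 - ℓ)) := by
    have := (Measure.measurePreserving_neg (volume : Measure ℝ)).setLIntegral_comp_preimage_emb
      (MeasurableEquiv.neg ℝ).measurableEmbedding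
      (fun u => ENNReal.ofReal (4 * π ^ 2 * r * |u| / √(r ^ 2 * u ^ 2 - ℓ))) (Ioo α β)
    rw [← this]
    simp
  rw [hS, lintegral_union (measurable_neg measurableSet_Ioo) hd, hn, hp,
    ← ENNReal.ofReal_add (by positivity) (by positivity)]
  congr 1
  have : r ^ 2 * β ^ 2 - ℓ = r ^ 2 * (w - ℓ / r ^ 2) := by rw [hβ2]; field_simp
  rw [this, Real.sqrt_mul (by positivity), Real.sqrt_sq hr.le]
  field_simp; ring

lemma radPoint_props {r u ℓ : ℝ} (hr : 0 < r) (hℓ : 0 < ℓ) (hu : ℓ < r ^ 2 * u ^ 2) :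
    ‖(radPoint r u ℓ).2‖ ^ 2 = u ^ 2 ∧ ellOf (radPoint r u ℓ) = ℓ := by
  have hu0 : u ≠ 0 := by rintro rfl; simp at hu; linarith
  have hs : Real.sign u ^ 2 = 1 := by
    rcases Real.sign_apply_eq_of_ne_zero u hu0 with h | h <;> rw [h] <;> norm_num
  set A := Real.sign u * √(r ^ 2 * u ^ 2 - ℓ) / r with hA
  set B := √ℓ / r with hB
  have hA2 : A ^ 2 = (r ^ 2 * u ^ 2 - ℓ) / r ^ 2 := by
    rw [hA, div_pow, mul_pow, hs, Real.sq_sqrt (by linarith), one_mul]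
  have hB2 : B ^ 2 = ℓ / r ^ 2 := by
    rw [hB, div_pow, Real.sq_sqrt hℓ.le]
  have h1 : ‖(radPoint r u ℓ).2‖ ^ 2 = A ^ 2 + B ^ 2 := by
    rw [EuclideanSpace.norm_sq_eq, Fin.sum_univ_three]
    simp [radPoint, ← hA, ← hB]
  have h2 : ‖(radPoint r u ℓ).1‖ ^ 2 = r ^ 2 := by
    rw [EuclideanSpace.norm_sq_eq, Fin.sum_univ_three]
    simp [radPoint]
  have h3 : (inner ℝ (radPoint r u ℓ).1 (radPoint r u ℓ).2 : ℝ) = r * A := by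
    rw [PiLp.inner_apply, Fin.sum_univ_three]
    simp [radPoint, ← hA, ← hB, mul_comm]
  constructor
  · rw [h1, hA2, hB2]; field_simp; ring
  · rw [ellOf, h1, h2, h3, mul_pow, hA2, hB2]; field_simp; ring

lemma nu_eq {Q : Phase → ℝ} {F : ℝ → ℝ → ℝ} {e₀ : ℝ} (hQ : AssumptionA Q F e₀) {s ℓ : ℝ}
    (hℓ : 0 < ℓ) :
    muDist Q s ℓ = ∫⁻ p in {p : ℝ × ℝ | 0 < p.1 ∧ ℓ < p.1 ^ 2 * p.2 ^ 2 ∧ 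
      s < F (p.2 ^ 2 / 2 + phiRad Q p.1) ℓ},
      ENNReal.ofReal (4 * π ^ 2 * p.1 * |p.2| / Real.sqrt (p.1 ^ 2 * p.2 ^ 2 - ℓ)) := by
  set T : Set (ℝ × ℝ) := {p | 0 < p.1 ∧ ℓ < p.1 ^ 2 * p.2 ^ 2} with hT
  have hTm : MeasurableSet T := by
    have a1 : MeasurableSet {p : ℝ × ℝ | 0 < p.1} := measurableSet_lt (by fun_prop) (by fun_prop)
    have a2 : MeasurableSet {p : ℝ × ℝ | ℓ < p.1 ^ 2 * p.2 ^ 2} :=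
      measurableSet_lt (by fun_prop) (by fun_prop)
    exact a1.inter a2
  have hnd : nuDens ℓ = T.indicator (fun p => ENNReal.ofReal (4 * π ^ 2 * p.1 * |p.2| / Real.sqrt (p.1 ^ 2 * p.2 ^ 2 - ℓ))) := by
    funext p
    simp only [nuDens, indicator, hT, mem_ofPred_eq]
  rw [muDist, nuMeas, withDensity_apply', hnd, lintegral_indicator hTm, Measure.restrict_restrict hTm]
  congr 2
  ext p
  simp only [hT, mem_inter_iff, mem_ofPred_eq, and_assoc]
  refine and_congr_right fun h1 => and_congr_right fun h2 => ?_
  obtain ⟨h3, h4⟩ := radPoint_props h1 hℓ h2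
  rw [hQ.eqF, h4, microE, h3]
  rfl

lemma mu_val {Q : Phase → ℝ} {F : ℝ → ℝ → ℝ} {e₀ : ℝ} (hQ : AssumptionA Q F e₀)
    (h : GoodPot (phiRad Q)) {s ℓ E : ℝ}
    (hℓ : 0 < ℓ) (hE : E < 0) (hs : ∀ e, s < F e ℓ ↔ e < E) :
    muDist Q s ℓ = ENNReal.ofReal (aPot (phiRad Q) E ℓ) := by
  rw [nu_eq hQ hℓ]
  simp only [hs]
  set φ := phiRad Q
  set B : Set (ℝ × ℝ) := {p : ℝ × ℝ | 0 < p.1 ∧ ℓ < p.1 ^ 2 * p.2 ^ 2 ∧ p.2 ^ 2 / 2 + φ p.1 < E} with hB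
  have hBm : MeasurableSet B := by
    have hc : ContinuousOn (fun p : ℝ × ℝ => p.2 ^ 2 / 2 + φ p.1) {p | 0 < p.1} := by
      refine ContinuousOn.add (by fun_prop) ?_
      exact h.contPhi.comp continuousOn_fst (fun p hp => hp)
    have ho : IsOpen {p : ℝ × ℝ | 0 < p.1} := isOpen_lt (by fun_prop) (by fun_prop)
    have h1 := (hc.isOpen_inter_preimage ho (isOpen_Iio (a := E))).measurableSet
    have h2 : MeasurableSet {p : ℝ × ℝ | ℓ < p.1 ^ 2 * p.2 ^ 2} := measurableSet_lt (by fun_prop) (by fun_prop)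
    convert h1.inter h2 using 1
    ext p
    simp only [hB, mem_inter_iff, mem_preimage, mem_ofPred_eq, mem_Iio]
    tauto
  rw [← lintegral_indicator hBm, Measure.volume_eq_prod, lintegral_prod]
  swap
  · exact (Measurable.indicator (by fun_prop) hBm).aemeasurable
  have inner : ∀ r : ℝ, ∫⁻ u, B.indicator (fun p => ENNReal.ofReal (4 * π ^ 2 * p.1 * |p.2| / Real.sqrt (p.1 ^ 2 * p.2 ^ 2 - ℓ))) (r, u)
      = (Ioi (0:ℝ)).indicator (fun r => ENNReal.ofReal (8 * π ^ 2 * √2 * √(E - psiPot φ ℓ r))) r := by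
    intro r
    by_cases hr : 0 < r
    · rw [indicator_of_mem (mem_Ioi.2 hr)]
      have e2 : 8 * π ^ 2 * √2 * √(E - psiPot φ ℓ r) = 8 * π ^ 2 * √(2 * (E - φ r) - ℓ / r ^ 2) := by
        rw [mul_assoc, ← Real.sqrt_mul (by norm_num)]
        congr 2
        rw [psiPot]; field_simp; ring
      rw [e2, ← innerU hr hℓ, ← lintegral_indicator]
      · refine lintegral_congr fun u => ?_
        have : (r, u) ∈ B ↔ u ∈ {u : ℝ | ℓ < r ^ 2 * u ^ 2 ∧ u ^ 2 < 2 * (E - φ r)} := by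
          simp only [hB, mem_ofPred_eq, hr, true_and]
          refine and_congr_right fun _ => ?_
          constructor <;> intro <;> linarith
        by_cases hu : (r, u) ∈ B
        · rw [indicator_of_mem hu, indicator_of_mem (this.1 hu)]
        · rw [indicator_of_notMem hu, indicator_of_notMem (fun h => hu (this.2 h))]
      · have a1 : MeasurableSet {u : ℝ | ℓ < r ^ 2 * u ^ 2} :=
          measurableSet_lt (by fun_prop) (by fun_prop)
        have a2 : MeasurableSet {u : ℝ | u ^ 2 < 2 * (E - φ r)} :=
          measurableSet_lt (by fun_prop) (by fun_prop)
        exact a1.inter a2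
    · rw [indicator_of_notMem (by simpa using hr)]
      rw [← lintegral_zero (μ := (volume : Measure ℝ))]
      refine lintegral_congr fun u => ?_
      rw [indicator_of_notMem]
      exact fun h => hr h.1
  simp_rw [inner]
  rw [lintegral_indicator measurableSet_Ioi, ← ofReal_integral_eq_lintegral_ofReal
    ((h.integr hℓ hE).const_mul _) (ae_of_all _ fun r => by positivity), aPot_eq, integral_const_mul]

lemma mu_zero {Q : Phase → ℝ} {F : ℝ → ℝ → ℝ} {e₀ : ℝ} (hQ : AssumptionA Q F e₀) {s ℓ : ℝ}
    (hℓ : 0 < ℓ) (hs : ∀ e, F e ℓ ≤ s) : muDist Q s ℓ = 0 := by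
  rw [nu_eq hQ hℓ]
  have : {p : ℝ × ℝ | 0 < p.1 ∧ ℓ < p.1 ^ 2 * p.2 ^ 2 ∧ 
      s < F (p.2 ^ 2 / 2 + phiRad Q p.1) ℓ} = ∅ := by
    ext p
    simp only [mem_ofPred_eq, mem_empty_iff_false, iff_false]
    rintro ⟨_, _, h⟩
    exact absurd h (not_lt.2 (hs _))
  rw [this]; simp

lemma F_cont {Q : Phase → ℝ} {F : ℝ → ℝ → ℝ} {e₀ : ℝ} (hQ : AssumptionA Q F e₀) {ℓ : ℝ}
    (hℓ : 0 ≤ ℓ) : Continuous (fun e => F e ℓ) :=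
  hQ.Fcont.comp_continuous (f := fun e : ℝ => (e, ℓ)) (by fun_prop) (fun _ => hℓ)

lemma F_key {Q : Phase → ℝ} {F : ℝ → ℝ → ℝ} {e₀ : ℝ} (hQ : AssumptionA Q F e₀) {ℓ : ℝ}
    (hℓ : 0 ≤ ℓ) {a b : ℝ} (hab : a < b) (hb : 0 < F b ℓ) : F b ℓ < F a ℓ := by
  have hc := F_cont hQ hℓ
  -- positivity on [a,b]
  have hpos : ∀ x ∈ Icc a b, 0 < F x ℓ := by
    by_contra! hh
    obtain ⟨x, hx, hx0⟩ := hh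
    set Z := {y | y ∈ Icc a b ∧ F y ℓ ≤ 0} with hZ
    have hZc : IsCompact Z := by
      have : Z = Icc a b ∩ {y | F y ℓ ≤ 0} := rfl
      rw [this]
      exact isCompact_Icc.inter_right (isClosed_le hc continuous_const)
    obtain ⟨m, hm, hmax⟩ := hZc.exists_isGreatest ⟨x, hx, hx0⟩
    have hmb : m < b := lt_of_le_of_ne hm.1.2 (by rintro rfl; linarith [hm.2])
    have hp : ∀ y ∈ Ioo m b, 0 < F y ℓ := by
      intro y hy
      by_contra! h'
      have := hmax ⟨⟨hm.1.1.trans hy.1.le, hy.2.le⟩, h'⟩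
      linarith [hy.1]
    have := strictAntiOn_of_deriv_neg (convex_Icc m b) hc.continuousOn (by
      rw [interior_Icc]
      exact fun y hy => hQ.FeNeg y ℓ hℓ (hp y hy))
    have := this (left_mem_Icc.2 hmb.le) (right_mem_Icc.2 hmb.le) hmb
    simp only at this
    linarith [hm.2]
  have := strictAntiOn_of_deriv_neg (convex_Icc a b) hc.continuousOn (by
    rw [interior_Icc]
    exact fun y hy => hQ.FeNeg y ℓ hℓ (hpos y ⟨hy.1.le, hy.2.le⟩))
  exact this (left_mem_Icc.2 hab.le) (right_mem_Icc.2 hab.le) hab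

lemma F_level {Q : Phase → ℝ} {F : ℝ → ℝ → ℝ} {e₀ : ℝ} (hQ : AssumptionA Q F e₀) {s ℓ : ℝ}
    (hℓ : 0 ≤ ℓ) (hs : 0 ≤ s) :
    (∀ e, F e ℓ ≤ s) ∨ ∃ E < 0, ∀ e, s < F e ℓ ↔ e < E := by
  by_cases hne : ∀ e, F e ℓ ≤ s
  · exact Or.inl hne
  right
  push Not at hne
  set S := {e | s < F e ℓ} with hS
  have hSn : S.Nonempty := hne
  have hub : ∀ e ∈ S, e < e₀ := fun e he => hQ.Fsupp e ℓ hℓ (hs.trans_lt he)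
  have hbdd : BddAbove S := ⟨e₀, fun e he => (hub e he).le⟩
  have hop : IsOpen S := isOpen_lt continuous_const (F_cont hQ hℓ)
  refine ⟨sSup S, (csSup_le hSn fun e he => (hub e he).le).trans_lt hQ.e₀neg, fun e => ⟨fun he => ?_, fun he => ?_⟩⟩
  · have n1 : ∀ᶠ y in 𝓝[>] e, y ∈ S := nhdsWithin_le_nhds (hop.mem_nhds he)
    have n2 : ∀ᶠ y in 𝓝[>] e, y ∈ Ioi e := self_mem_nhdsWithin
    obtain ⟨e', h1, h2⟩ := (n1.and n2).exists
    exact lt_of_lt_of_le h2 (le_csSup hbdd h1)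
  · obtain ⟨e', h1, h2⟩ := exists_lt_of_lt_csSup hSn he
    have h1 : s < F e' ℓ := h1
    exact h1.trans (F_key hQ hℓ h2 (hs.trans_lt h1))

lemma good {Q : Phase → ℝ} {F : ℝ → ℝ → ℝ} {e₀ : ℝ} (hQ : AssumptionA Q F e₀) : GoodPot (phiRad Q) :=
  ⟨(phi_props hQ.contQ hQ.cpt hQ.nonneg hQ.sph).1, (phi_props hQ.contQ hQ.cpt hQ.nonneg hQ.sph).2⟩

/-- the second part -/
lemma part2 {Q : Phase → ℝ} {F : ℝ → ℝ → ℝ} {e₀ : ℝ} (hQ : AssumptionA Q F e₀) {ℓ e : ℝ}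
    (hℓ : 0 < ℓ) (hm : eMinPot (phiRad Q) ℓ ≤ e) (he : e < 0) :
    schwarz Q (aPot (phiRad Q) e ℓ) ℓ = F e ℓ := by
  have h := good hQ
  have key : ∀ s, 0 ≤ s → (ENNReal.ofReal (aPot (phiRad Q) e ℓ) < muDist Q s ℓ ↔ s < F e ℓ) := by
    intro s hs
    rcases F_level hQ hℓ.le hs with h0 | ⟨E, hE, hE'⟩
    · rw [mu_zero hQ hℓ h0]
      simp [h0 e]
    · rw [mu_val hQ h hℓ hE hE', hE']
      constructor
      · intro hlt
        by_contra! hh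
        exact absurd hlt (not_lt.2 (ENNReal.ofReal_le_ofReal (h.aMono hℓ hh he)))
      · intro hlt
        have := h.aStrict hℓ hlt hE hm
        exact (ENNReal.ofReal_lt_ofReal_iff ((aPot_nonneg _ _ _).trans_lt this)).2 this
  rw [schwarz]
  split_ifs with h0
  · rw [key 0 le_rfl] at h0
    have : {s : ℝ | 0 ≤ s ∧ ENNReal.ofReal (aPot (phiRad Q) e ℓ) < muDist Q s ℓ} = Ico 0 (F e ℓ) := by
      ext s
      simp only [mem_ofPred_eq, mem_Ico]
      exact and_congr_right fun hs => key s hs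
    rw [this, csSup_Ico h0]
  · rw [key 0 le_rfl] at h0
    exact le_antisymm (hQ.Fnonneg e ℓ hℓ.le) (not_lt.1 h0)

lemma aPot_zero {φ : ℝ → ℝ} (h : GoodPot φ) {ℓ e : ℝ} (hℓ : 0 < ℓ) (he : e ≤ eMinPot φ ℓ) : aPot φ e ℓ = 0 := by
  rw [aPot_eq, setIntegral_congr_fun (g := fun _ => 0) measurableSet_Ioi]
  · simp
  · intro r hr
    simp only
    apply Real.sqrt_eq_zero_of_nonpos
    have := csInf_le (h.bddPsi hℓ) (mem_image_of_mem _ hr)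
    change eMinPot φ ℓ ≤ _ at this
    linarith

lemma aPot_cont {φ : ℝ → ℝ} (h : GoodPot φ) {ℓ : ℝ} (hℓ : 0 < ℓ) :
    ContinuousOn (fun e => aPot φ e ℓ) (Iio 0) := by
  intro e he
  have he : e < 0 := he
  apply ContinuousAt.continuousWithinAt
  simp only [aPot_eq]
  refine continuousAt_const.mul ?_
  refine continuousAt_of_dominated (bound := fun r => √(e / 2 - psiPot φ ℓ r)) ?_ ?_ (h.integr hℓ (by linarith)) ?_
  · filter_upwards [eventually_lt_nhds he] with e' he'
    exact (h.integr hℓ he').aestronglyMeasurable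
  · filter_upwards [eventually_lt_nhds (show e < e / 2 by linarith)] with e' he'
    refine ae_of_all _ fun r => ?_
    rw [Real.norm_of_nonneg (Real.sqrt_nonneg _)]
    exact Real.sqrt_le_sqrt (by linarith)
  · exact ae_of_all _ fun r => by fun_prop

lemma part3 {Q : Phase → ℝ} {F : ℝ → ℝ → ℝ} {e₀ : ℝ} (hQ : AssumptionA Q F e₀) {ℓ : ℝ}
    (hℓ : 0 < ℓ) :
    ContDiffOn ℝ 1 (fun s => schwarz Q s ℓ) (Ioo 0 ((muDist Q 0 ℓ).toReal)) := by
  have h := good hQ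
  intro t ht
  apply ContDiffAt.contDiffWithinAt
  rcases F_level hQ hℓ.le le_rfl with h0 | ⟨E, hE, hE'⟩
  · rw [mu_zero hQ hℓ h0] at ht
    simp only [ENNReal.toReal_zero, mem_Ioo] at ht
    linarith
  rw [mu_val hQ h hℓ hE hE', ENNReal.toReal_ofReal (aPot_nonneg _ _ _)] at ht
  have hmE : eMinPot (phiRad Q) ℓ < E := by
    by_contra! hh
    rw [aPot_zero h hℓ hh] at ht
    linarith [ht.1, ht.2]
  obtain ⟨e, ⟨he1, he2⟩, het⟩ := intermediate_value_Ioo hmE.le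
    ((aPot_cont h hℓ).mono fun x hx => lt_of_le_of_lt hx.2 hE)
    (show t ∈ _ by rw [aPot_zero h hℓ le_rfl]; exact ht)
  obtain ⟨hC, d, hd, hD⟩ := h.aC1 hℓ he1 (he2.trans hE)
  set A := fun e => aPot (phiRad Q) e ℓ with hA
  have hF' : HasFDerivAt A (ContinuousLinearEquiv.unitsEquivAut ℝ (Units.mk0 d hd) : ℝ →L[ℝ] ℝ) e := by
    have := hD.hasFDerivAt
    have e : (ContinuousLinearEquiv.unitsEquivAut ℝ (Units.mk0 d hd) : ℝ →L[ℝ] ℝ) =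
        ContinuousLinearMap.toSpanSingleton ℝ d := by
      ext
      simp
    rw [e]
    exact this
  have hinv := hC.to_localInverse hF' (by norm_num)
  set g := hC.localInverse hF' (by norm_num) with hg
  have hS := hC.hasStrictFDerivAt' hF' (by norm_num)
  have hright : ∀ᶠ y in 𝓝 (A e), A (g y) = y := hS.eventually_right_inverse
  have hge : g (A e) = e := hS.localInverse_apply_image
  rw [het] at hinv hright hge
  have hgc : ContinuousAt g t := hinv.continuousAt
  have hFe : 0 < F e ℓ := (hE' e).2 he2
  have hFC : ContDiffAt ℝ 1 (fun e => F e ℓ) (g t) := by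
    rw [hge]
    have h1 : ContDiffWithinAt ℝ 1 (fun e => F e ℓ) (Iio E) e := by
      refine (hQ.FC1 (e, ℓ) ⟨hℓ.le, hFe⟩).comp (t := {p : ℝ × ℝ | 0 ≤ p.2 ∧ 0 < F p.1 p.2})
        (f := fun e : ℝ => (e, ℓ)) e (by fun_prop) ?_
      exact fun x hx => ⟨hℓ.le, (hE' x).2 hx⟩
    exact h1.contDiffAt (Iio_mem_nhds he2)
  refine (hFC.comp t hinv).congr_of_eventuallyEq ?_
  have hn : ∀ᶠ y in 𝓝 t, g y ∈ Ioo (eMinPot (phiRad Q) ℓ) E := by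
    apply hgc.eventually_mem
    rw [hge]
    exact isOpen_Ioo.mem_nhds ⟨he1, he2⟩
  filter_upwards [hright, hn] with y hy hgy
  have := part2 hQ hℓ hgy.1.le (hgy.2.trans hE)
  simp only [hA] at hy
  rw [hy] at this
  exact this

lemma ell_ae : ∀ᵐ z : Phase, z.1 ≠ 0 ∧ 0 < ellOf z := by
  have hm : MeasurableSet {z : Phase | z.1 ≠ 0 ∧ 0 < ellOf z} := by
    apply MeasurableSet.inter
    · exact (measurableSet_eq_fun measurable_fst measurable_const).compl
    · have hc : Continuous ellOf := by unfold ellOf; fun_prop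
      exact measurableSet_lt measurable_const hc.measurable
  rw [Measure.volume_eq_prod, Measure.ae_prod_iff_ae_ae hm]
  have hx : ∀ᵐ x : E3, x ≠ 0 := by
    rw [ae_iff]; simp
  filter_upwards [hx] with x hx
  have hnull : volume ((Submodule.span ℝ {x} : Submodule ℝ E3) : Set E3) = 0 := by
    apply Measure.addHaar_submodule
    intro htop
    have h1 := finrank_span_singleton (K := ℝ) hx
    rw [htop, finrank_top, finrank_euclideanSpace_fin] at h1
    norm_num at h1
  have : ∀ᵐ v : E3, v ∉ ((Submodule.span ℝ {x} : Submodule ℝ E3) : Set E3) := measure_eq_zero_iff_ae_notMem.1 hnull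
  filter_upwards [this] with v hv
  refine ⟨hx, ?_⟩
  have hx2 : 0 < ‖x‖ ^ 2 := by positivity
  set c := (inner ℝ x v : ℝ) / ‖x‖ ^ 2 with hc
  have hne : v - c • x ≠ 0 := by
    intro hh
    apply hv
    rw [sub_eq_zero.1 hh]
    exact Submodule.smul_mem _ _ (Submodule.mem_span_singleton_self x)
  have h1 : 0 < ‖v - c • x‖ ^ 2 := by positivity
  rw [norm_sub_sq_real, inner_smul_right, norm_smul, mul_pow, Real.norm_eq_abs, sq_abs, real_inner_comm] at h1
  have h2 : ellOf (x, v) = ‖x‖ ^ 2 * (‖v‖ ^ 2 - 2 * (c * inner ℝ x v) + c ^ 2 * ‖x‖ ^ 2) := by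
    rw [ellOf, hc]; field_simp; ring
  change 0 < ellOf (x, v)
  rw [h2]
  exact mul_pos hx2 h1

lemma part1 {Q : Phase → ℝ} {F : ℝ → ℝ → ℝ} {e₀ : ℝ} (hQ : AssumptionA Q F e₀) :
    rearr Q Q =ᵐ[volume] Q := by
  have h := good hQ
  filter_upwards [ell_ae] with z hz
  obtain ⟨hx, hl⟩ := hz
  have hx0 : 0 < ‖z.1‖ := norm_pos_iff.2 hx
  rw [rearr]
  split_ifs with he
  · rw [part2 hQ hl ?_ he, ← hQ.eqF]
    refine (csInf_le (h.bddPsi hl) (mem_image_of_mem _ (mem_Ioi.2 hx0))).trans ?_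
    rw [psiPot, microE, phi_rad hQ.sph, add_comm]
    refine add_le_add ?_ le_rfl
    rw [div_le_div_iff₀ (by positivity) (by norm_num), ellOf]
    nlinarith [sq_nonneg (inner ℝ z.1 z.2 : ℝ)]
  · rw [hQ.eqF]
    by_contra hne
    have := hQ.Fsupp _ _ hl.le (lt_of_le_of_ne (hQ.Fnonneg (microE Q z) _ hl.le) hne)
    linarith [hQ.e₀neg]

/-- Identification of `Q^{*φ_Q}` for a steady state satisfying Assumption (A). -/
theorem stmt14 (Q : Phase → ℝ) (F : ℝ → ℝ → ℝ) (e₀ : ℝ) (hQ : AssumptionA Q F e₀) :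
    (rearr Q Q =ᵐ[volume] Q) ∧
    (∀ ℓ : ℝ, 0 < ℓ → ∀ e : ℝ, eMinPot (phiRad Q) ℓ ≤ e → e < 0 →
      schwarz Q (aPot (phiRad Q) e ℓ) ℓ = F e ℓ) ∧
    (∀ ℓ : ℝ, 0 < ℓ →
      ContDiffOn ℝ 1 (fun s => schwarz Q s ℓ) (Ioo 0 ((muDist Q 0 ℓ).toReal))) := by
  exact ⟨part1 hQ, fun ℓ hℓ e h1 h2 => part2 hQ hℓ h1 h2, fun ℓ hℓ => part3 hQ hℓ⟩
end
end

section
/- Let f ∈ E_rad, let φ ∈ Φ_rad be nonzero, and let ℓ > 0 be such that f^*(0,ℓ) > 0. Then the map e ↦ f^*(a_φ(e,ℓ),ℓ) is nonincreasing from [e_{φ,ℓ}, 0) into [0, f^*(0,ℓ)]; define its pseudo-inverse (f^*∘a_φ)^{−1}(s,ℓ) = sup{e ∈ [e_{φ,ℓ}, 0) : f^*(a_φ(e,ℓ),ℓ) > s} for s ∈ (0, f^*(0,ℓ)). Then s ↦ (f^*∘a_φ)^{−1}(s,ℓ) is nonincreasing, and for every (x,v) ∈ ℝ⁶ with |x×v|²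 = ℓ and every s ∈ (0, f^*(0,ℓ)): if f^{*φ}(x,v) > s then |v|²/2 + φ(x) ≤ (f^*∘a_φ)^{−1}(s,ℓ), and if f^{*φ}(x,v) ≤ s then |v|²/2 + φ(x) ≥ (f^*∘a_φ)^{−1}(s,ℓ). -/
noncomputable section

open MeasureTheory Real Filter Set Topology
open scoped ENNReal NNReal

/-- Pseudo inverse of `e ↦ f^*(a_φ(e,ℓ),ℓ)`. -/
def pseudoInv (f g : Phase → ℝ) (s ℓ : ℝ) : ℝ :=
  sSup {e : ℝ | eMinPot (phiRad g) ℓ ≤ e ∧ e < 0 ∧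
    s < schwarz f (aPot (phiRad g) e ℓ) ℓ}


namespace S15

def kk (w : E3) : ℝ≥0∞ := ENNReal.ofReal (‖w‖⁻¹)

lemma kk_meas : Measurable kk := by unfold kk; fun_prop

def GG (g : Phase → ℝ) (x : E3) : ℝ≥0∞ := ∫⁻ z : Phase, ‖g z‖ₑ * kk (x - z.1)

def NN (lam : ℝ) (w : E3) : ℝ≥0∞ := kk w * volume {v : E3 | lam * ‖v‖ ^ 2 < ‖w‖⁻¹}

lemma integ52 : IntegrableOn (fun w : E3 => ‖w‖ ^ (-(5/2) : ℝ)) (Metric.ball 0 1) := by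
  rw [integrableOn_fun_norm_addHaar volume (f := fun r : ℝ => r ^ (-(5/2) : ℝ))]
  have h := (intervalIntegral.integrableOn_Ioo_rpow_iff (s := (-(1/2) : ℝ)) (t := 1) one_pos).2
    (by norm_num)
  refine h.congr_fun ?_ measurableSet_Ioo
  intro y hy
  have h0 : 0 < y := hy.1
  simp only [finrank_euclideanSpace, Fintype.card_fin, smul_eq_mul]
  rw [← Real.rpow_natCast, ← Real.rpow_add h0]
  norm_num

lemma NN_le (lam : ℝ) (hl : 0 < lam) (w : E3) :
    NN lam w ≤ ENNReal.ofReal (lam ^ (-(3/2) : ℝ)) * volume (Metric.ball (0:E3) 1) *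
      ENNReal.ofReal (‖w‖ ^ (-(5/2) : ℝ)) := by
  unfold NN kk
  rcases eq_or_lt_of_le (norm_nonneg w) with h0 | h0
  · rw [← h0]; simp
  have hs : {v : E3 | lam * ‖v‖ ^ 2 < ‖w‖⁻¹} ⊆ Metric.ball 0 ((lam * ‖w‖) ^ (-(1/2) : ℝ)) := by
    intro v hv
    have hv : lam * ‖v‖ ^ 2 < ‖w‖⁻¹ := hv
    rw [mem_ball_zero_iff]
    have hp : 0 < lam * ‖w‖ := by positivity
    refine lt_of_pow_lt_pow_left₀ 2 (by positivity) ?_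
    rw [← Real.rpow_natCast ((lam * ‖w‖) ^ (-(1/2) : ℝ)), ← Real.rpow_mul hp.le]
    norm_num
    rw [Real.rpow_neg_one, mul_inv]
    rw [lt_inv_mul_iff₀ hl]; exact hv
  calc _ ≤ ENNReal.ofReal ‖w‖⁻¹ * volume (Metric.ball (0:E3) ((lam * ‖w‖) ^ (-(1/2) : ℝ))) := by
        gcongr
    _ = _ := by
        rw [Measure.addHaar_ball_of_pos _ _ (by positivity)]
        rw [← mul_assoc, ← ENNReal.ofReal_mul (by positivity), mul_right_comm,
          ← ENNReal.ofReal_mul (by positivity)]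
        congr 2
        simp only [finrank_euclideanSpace, Fintype.card_fin]
        rw [← Real.rpow_natCast, ← Real.rpow_mul (by positivity), Real.mul_rpow hl.le h0.le,
          ← Real.rpow_neg_one, mul_left_comm, ← Real.rpow_add h0]
        norm_num

lemma NN_fin (lam : ℝ) (hl : 0 < lam) : ∫⁻ w in Metric.ball (0:E3) 1, NN lam w ≠ ⊤ := by
  refine ne_top_of_le_ne_top ?_ (lintegral_mono (NN_le lam hl))
  rw [lintegral_const_mul' _ _ (ENNReal.mul_ne_top ENNReal.ofReal_ne_top measure_ball_lt_top.ne)]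
  refine ENNReal.mul_ne_top (ENNReal.mul_ne_top ENNReal.ofReal_ne_top measure_ball_lt_top.ne) ?_
  exact integ52.lintegral_lt_top.ne

lemma near_small (lam : ℝ) (hl : 0 < lam) :
    Tendsto (fun δ : ℝ => ∫⁻ w in Metric.ball (0:E3) δ, NN lam w) (𝓝[>] 0) (𝓝 0) := by
  have h := tendsto_setLIntegral_zero (NN_fin lam hl) (l := 𝓝[>] (0:ℝ))
    (s := fun δ => Metric.ball (0:E3) δ) ?_
  · refine h.congr' ?_
    filter_upwards [Ioo_mem_nhdsGT (zero_lt_one (α := ℝ))] with δ hδ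
    rw [Measure.restrict_restrict Metric.isOpen_ball.measurableSet,
      inter_eq_left.2 (Metric.ball_subset_ball hδ.2.le)]
  · have h1 : Tendsto (fun δ : ℝ => ENNReal.ofReal (δ ^ 3) * volume (Metric.ball (0:E3) 1))
        (𝓝[>] 0) (𝓝 0) := by
      have : Tendsto (fun δ : ℝ => ENNReal.ofReal (δ ^ 3)) (𝓝[>] 0) (𝓝 0) := by
        have hc : Continuous (fun δ : ℝ => ENNReal.ofReal (δ ^ 3)) :=
          ENNReal.continuous_ofReal.comp (by fun_prop)
        have := (hc.tendsto 0).mono_left (nhdsWithin_le_nhds (s := Ioi 0))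
        simpa using this
      have := ENNReal.Tendsto.mul_const this
        (b := volume (Metric.ball (0:E3) 1)) (Or.inr measure_ball_lt_top.ne)
      simpa using this
    refine tendsto_of_tendsto_of_tendsto_of_le_of_le' tendsto_const_nhds h1
      (Eventually.of_forall fun _ => zero_le) ?_
    filter_upwards [self_mem_nhdsWithin] with δ hδ
    refine (Measure.restrict_apply_le _ _).trans ?_
    rw [Measure.addHaar_ball_of_pos _ _ hδ]
    simp

def TT (g : Phase → ℝ) (δ : ℝ) (x : E3) : ℝ≥0∞ :=
  ∫⁻ z : Phase, ‖g z‖ₑ * min (kk (x - z.1)) (ENNReal.ofReal δ⁻¹)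

def KK (g : Phase → ℝ) : ℝ≥0∞ := ∫⁻ z : Phase, ‖z.2‖ₑ ^ 2 * ‖g z‖ₑ

lemma near_bound (g : Phase → ℝ) (hg : Measurable g) (lam δ : ℝ) (x : E3) :
    ∫⁻ z, ({z : Phase | x - z.1 ∈ Metric.ball 0 δ ∧ lam * ‖z.2‖ ^ 2 < ‖x - z.1‖⁻¹}).indicator
      (fun z => ‖g z‖ₑ * kk (x - z.1)) z ≤
    eLpNorm g ⊤ volume * ∫⁻ w in Metric.ball (0:E3) δ, NN lam w := by
  set S := {z : Phase | x - z.1 ∈ Metric.ball 0 δ ∧ lam * ‖z.2‖ ^ 2 < ‖x - z.1‖⁻¹} with hS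
  have hSm : MeasurableSet S := by
    refine MeasurableSet.inter ?_ ?_
    · exact (measurable_const.sub measurable_fst) Metric.isOpen_ball.measurableSet
    · exact measurableSet_lt (f := fun z : Phase => lam * ‖z.2‖ ^ 2)
        (g := fun z : Phase => ‖x - z.1‖⁻¹) (by fun_prop) (by fun_prop)
  have hkm : Measurable (fun z : Phase => kk (x - z.1)) :=
    kk_meas.comp (measurable_const.sub measurable_fst)
  calc _ ≤ ∫⁻ z, eLpNorm g ⊤ volume * S.indicator (fun z => kk (x - z.1)) z := by
        refine lintegral_mono_ae ?_
        filter_upwards [enorm_ae_le_eLpNormEssSup g volume] with z hz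
        by_cases h : z ∈ S
        · simp only [indicator_of_mem h, eLpNorm_exponent_top]; gcongr
        · simp [indicator_of_notMem h]
    _ = eLpNorm g ⊤ volume * ∫⁻ z, S.indicator (fun z => kk (x - z.1)) z :=
        lintegral_const_mul _ (hkm.indicator hSm)
    _ = eLpNorm g ⊤ volume * ∫⁻ y : E3, ∫⁻ v : E3, S.indicator (fun z => kk (x - z.1)) (y, v) := by
        rw [Measure.volume_eq_prod, lintegral_prod _ (hkm.indicator hSm).aemeasurable]
    _ = eLpNorm g ⊤ volume *
          ∫⁻ y : E3, (fun w => (Metric.ball (0:E3) δ).indicator (NN lam) w) (x - y) := by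
        congr 2
        ext y
        by_cases h : x - y ∈ Metric.ball (0:E3) δ
        · simp only [indicator_of_mem h, NN]
          have : ∀ v : E3, S.indicator (fun z => kk (x - z.1)) (y, v) =
              {v : E3 | lam * ‖v‖ ^ 2 < ‖x - y‖⁻¹}.indicator (fun _ => kk (x - y)) v := by
            intro v
            by_cases h2 : lam * ‖v‖ ^ 2 < ‖x - y‖⁻¹
            · rw [indicator_of_mem (show (y, v) ∈ S from ⟨h, h2⟩),
                indicator_of_mem (show v ∈ {v : E3 | lam * ‖v‖ ^ 2 < ‖x - y‖⁻¹} from h2)]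
            · rw [indicator_of_notMem (show (y, v) ∉ S from fun h3 => h2 h3.2),
                indicator_of_notMem (show v ∉ {v : E3 | lam * ‖v‖ ^ 2 < ‖x - y‖⁻¹} from h2)]
          simp_rw [this]
          rw [lintegral_indicator_const]
          exact measurableSet_lt (by fun_prop) (by fun_prop)
        · simp only [indicator_of_notMem h]
          have : ∀ v : E3, S.indicator (fun z => kk (x - z.1)) (y, v) = 0 := fun v =>
            indicator_of_notMem (show (y, v) ∉ S from fun h3 => h h3.1) _
          simp [this]
    _ = _ := by
        rw [lintegral_sub_left_eq_self, lintegral_indicator Metric.isOpen_ball.measurableSet]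

lemma GG_le (g : Phase → ℝ) (hg : Measurable g) (lam δ : ℝ) (hl : 0 < lam) (hδ : 0 < δ) (x : E3) :
    GG g x ≤ ENNReal.ofReal lam * KK g +
      eLpNorm g ⊤ volume * (∫⁻ w in Metric.ball (0:E3) δ, NN lam w) + TT g δ x := by
  have hkm : Measurable (fun z : Phase => kk (x - z.1)) :=
    kk_meas.comp (measurable_const.sub measurable_fst)
  set S := {z : Phase | x - z.1 ∈ Metric.ball 0 δ ∧ lam * ‖z.2‖ ^ 2 < ‖x - z.1‖⁻¹} with hS
  calc GG g x ≤ ∫⁻ z, ((ENNReal.ofReal lam * (‖z.2‖ₑ ^ 2 * ‖g z‖ₑ) +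
        S.indicator (fun z => ‖g z‖ₑ * kk (x - z.1)) z) +
        ‖g z‖ₑ * min (kk (x - z.1)) (ENNReal.ofReal δ⁻¹)) := by
        refine lintegral_mono fun z => ?_
        by_cases h1 : x - z.1 ∈ Metric.ball (0:E3) δ
        · by_cases h2 : lam * ‖z.2‖ ^ 2 < ‖x - z.1‖⁻¹
          · rw [indicator_of_mem (show z ∈ S from ⟨h1, h2⟩)]
            exact le_add_right le_add_self
          · refine le_add_right (le_add_right ?_)
            have : kk (x - z.1) ≤ ENNReal.ofReal lam * ‖z.2‖ₑ ^ 2 := by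
              rw [← ofReal_norm, ← ENNReal.ofReal_pow (norm_nonneg _),
                ← ENNReal.ofReal_mul hl.le]
              exact ENNReal.ofReal_le_ofReal (not_lt.1 h2)
            rw [mul_comm, ← mul_assoc]
            gcongr
        · refine le_add_left ?_
          have : kk (x - z.1) ≤ ENNReal.ofReal δ⁻¹ := by
            refine ENNReal.ofReal_le_ofReal ?_
            rw [mem_ball_zero_iff, not_lt] at h1
            gcongr
          rw [min_eq_left this]
    _ ≤ _ := by
        rw [lintegral_add_right _ (by fun_prop), lintegral_add_left (by fun_prop),
          lintegral_const_mul _ (by fun_prop)]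
        gcongr
        · exact le_rfl
        · exact near_bound g hg lam δ x
        · exact le_rfl

lemma fin_parts (g : Phase → ℝ) (hg : memE g) :
    (∫⁻ z, ‖g z‖ₑ ≠ ⊤) ∧ eLpNorm g ⊤ volume ≠ ⊤ ∧ KK g ≠ ⊤ := by
  have h := hg.2.2
  unfold eNormE at h
  rw [ENNReal.add_lt_top, ENNReal.add_lt_top] at h
  refine ⟨?_, h.1.2.ne, h.2.ne⟩
  have := h.1.1.ne
  rwa [eLpNorm_one_eq_lintegral_enorm] at this

lemma GG_bdd (g : Phase → ℝ) (hg : memE g) : ∃ C : ℝ≥0∞, C ≠ ⊤ ∧ ∀ x, GG g x ≤ C := by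
  obtain ⟨h1, h2, h3⟩ := fin_parts g hg
  refine ⟨_, ?_, fun x => (GG_le g hg.1 1 1 one_pos one_pos x).trans
    (add_le_add_right (b := TT g 1 x) (c := ∫⁻ z, ‖g z‖ₑ) ?_ _)⟩
  · have := NN_fin 1 one_pos
    finiteness
  · refine lintegral_mono fun z => ?_
    calc _ ≤ ‖g z‖ₑ * ENNReal.ofReal (1:ℝ)⁻¹ := by gcongr; exact min_le_right _ _
      _ = _ := by simp

lemma TT_tendsto (g : Phase → ℝ) (hg : memE g) (δ : ℝ) :
    Tendsto (TT g δ) (cocompact E3) (𝓝 0) := by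
  obtain ⟨h1, h2, h3⟩ := fin_parts g hg
  have hgm := hg.1
  haveI : (cocompact E3).IsCountablyGenerated := by
    rw [← Metric.cobounded_eq_cocompact, ← comap_norm_atTop]; infer_instance
  unfold TT
  have := tendsto_lintegral_filter_of_dominated_convergence (μ := (volume : Measure Phase))
    (l := cocompact E3) (F := fun x z => ‖g z‖ₑ * min (kk (x - z.1)) (ENNReal.ofReal δ⁻¹))
    (f := fun _ => 0) (fun z => ‖g z‖ₑ * ENNReal.ofReal δ⁻¹) ?_ ?_ ?_ ?_
  · simpa using this
  · refine Eventually.of_forall fun x => ?_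
    have hkm : Measurable (fun z : Phase => kk (x - z.1)) :=
      kk_meas.comp (measurable_const.sub measurable_fst)
    fun_prop
  · exact Eventually.of_forall fun x => Eventually.of_forall fun z => by
      gcongr; exact min_le_right _ _
  · rw [lintegral_mul_const _ (by fun_prop)]; finiteness
  · refine Eventually.of_forall fun z => ?_
    have hk : Tendsto (fun x : E3 => kk (x - z.1)) (cocompact E3) (𝓝 0) := by
      have h4 : Tendsto (fun x : E3 => ‖x - z.1‖) (cocompact E3) atTop := by
        refine tendsto_atTop_mono (fun x => norm_sub_norm_le x z.1) ?_
        exact tendsto_atTop_add_const_right _ (-‖z.1‖) (tendsto_norm_cocompact_atTop (E := E3))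
      have := ENNReal.tendsto_ofReal (tendsto_inv_atTop_zero.comp h4)
      simpa [kk] using this
    have h5 : Tendsto (fun x : E3 => ‖g z‖ₑ * kk (x - z.1)) (cocompact E3) (𝓝 0) := by
      have := ENNReal.Tendsto.const_mul hk (a := ‖g z‖ₑ) (Or.inr enorm_ne_top)
      simpa using this
    refine tendsto_of_tendsto_of_tendsto_of_le_of_le tendsto_const_nhds h5
      (fun _ => zero_le) fun x => ?_
    dsimp only; gcongr; exact min_le_left _ _

lemma GG_tendsto (g : Phase → ℝ) (hg : memE g) : Tendsto (GG g) (cocompact E3) (𝓝 0) := by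
  obtain ⟨h1, h2, h3⟩ := fin_parts g hg
  rw [ENNReal.tendsto_nhds_zero]
  intro ε hε
  have hε3 : 0 < ε / 3 := ENNReal.div_pos hε.ne' (by norm_num)
  -- choose lam
  have hA : Tendsto (fun lam : ℝ => ENNReal.ofReal lam * KK g) (𝓝[>] 0) (𝓝 0) := by
    have hc : Continuous (fun lam : ℝ => ENNReal.ofReal lam) := ENNReal.continuous_ofReal
    have := (hc.tendsto 0).mono_left (nhdsWithin_le_nhds (s := Ioi 0))
    have := ENNReal.Tendsto.mul_const this (b := KK g) (Or.inr h3)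
    simpa using this
  obtain ⟨lam, hlam, hl⟩ := ((ENNReal.tendsto_nhds_zero.1 hA _ hε3).and
    self_mem_nhdsWithin).exists
  have hB : Tendsto (fun δ : ℝ => eLpNorm g ⊤ volume *
      ∫⁻ w in Metric.ball (0:E3) δ, NN lam w) (𝓝[>] 0) (𝓝 0) := by
    have := ENNReal.Tendsto.const_mul (near_small lam hl) (a := eLpNorm g ⊤ volume) (Or.inr h2)
    simpa using this
  obtain ⟨δ, hδ', hδ⟩ := ((ENNReal.tendsto_nhds_zero.1 hB _ hε3).and
    self_mem_nhdsWithin).exists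
  filter_upwards [ENNReal.tendsto_nhds_zero.1 (TT_tendsto g hg δ) _ hε3] with x hx
  calc _ ≤ _ := GG_le g hg.1 lam δ hl hδ x
    _ ≤ ε / 3 + ε / 3 + ε / 3 := by gcongr
    _ = ε := ENNReal.add_thirds ε

lemma rho_meas (g : Phase → ℝ) (hg : Measurable g) : StronglyMeasurable (rhoF g) :=
  hg.stronglyMeasurable.integral_prod_right'

lemma phi_meas (g : Phase → ℝ) (hg : Measurable g) : StronglyMeasurable (phiF g) := by
  have hr := (rho_meas g hg).measurable
  have : Measurable (fun p : E3 × E3 => rhoF g p.2 / (4 * π * ‖p.1 - p.2‖)) :=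
    (hr.comp measurable_snd).div (by fun_prop)
  exact this.stronglyMeasurable.integral_prod_right'.neg

lemma phi_le (g : Phase → ℝ) (hg : Measurable g) (x : E3) : ‖phiF g x‖ₑ ≤ GG g x := by
  have hkm : Measurable (fun z : Phase => kk (x - z.1)) :=
    kk_meas.comp (measurable_const.sub measurable_fst)
  unfold phiF GG
  rw [enorm_neg]
  refine (enorm_integral_le_lintegral_enorm _).trans ?_
  rw [Measure.volume_eq_prod, lintegral_prod _ (by fun_prop)]
  refine lintegral_mono fun y => ?_
  have h1 : ‖rhoF g y / (4 * π * ‖x - y‖)‖ₑ ≤ ‖rhoF g y‖ₑ * kk (x - y) := by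
    rw [div_eq_mul_inv, enorm_mul]
    gcongr
    rw [← ofReal_norm, kk]
    refine ENNReal.ofReal_le_ofReal ?_
    rw [norm_inv, Real.norm_of_nonneg (by positivity), mul_inv]
    refine mul_le_of_le_one_left (by positivity) (inv_le_one_of_one_le₀ ?_)
    nlinarith [Real.pi_gt_three]
  refine h1.trans ?_
  dsimp only
  rw [lintegral_mul_const _ (by fun_prop)]
  gcongr
  exact enorm_integral_le_lintegral_enorm _

lemma phi_bdd (g : Phase → ℝ) (hg : memE g) : ∃ C : ℝ, ∀ x, |phiF g x| ≤ C := by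
  obtain ⟨C, hC, h⟩ := GG_bdd g hg
  refine ⟨C.toReal, fun x => ?_⟩
  have := ENNReal.toReal_mono hC ((phi_le g hg.1 x).trans (h x))
  simpa using this

lemma phi_tendsto (g : Phase → ℝ) (hg : memE g) : Tendsto (phiF g) (cocompact E3) (𝓝 0) := by
  have h : Tendsto (fun x => ‖phiF g x‖ₑ) (cocompact E3) (𝓝 0) :=
    tendsto_of_tendsto_of_tendsto_of_le_of_le tendsto_const_nhds (GG_tendsto g hg)
      (fun _ => zero_le) (phi_le g hg.1)
  have := (ENNReal.tendsto_toReal ENNReal.zero_ne_top).comp h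
  refine squeeze_zero_norm (fun x => le_rfl) ?_
  simpa [Function.comp_def] using this

lemma exists_rot (x : E3) : ∃ R : E3 ≃ₗᵢ[ℝ] E3,
    LinearMap.det (R.toLinearEquiv : E3 →ₗ[ℝ] E3) = 1 ∧
    R (‖x‖ • (EuclideanSpace.single (0 : Fin 3) (1:ℝ))) = x := by
  set a : E3 := ‖x‖ • (EuclideanSpace.single (0 : Fin 3) (1:ℝ)) with ha
  have hax : ‖a‖ = ‖x‖ := by simp [ha, norm_smul]
  by_cases hx : a = x
  · refine ⟨LinearIsometryEquiv.refl ℝ E3, ?_, hx⟩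
    exact LinearMap.det_id
  set b : E3 := EuclideanSpace.single (1 : Fin 3) (1:ℝ) with hb
  have hb0 : b ≠ 0 := by simp [hb]
  set R1 := Submodule.reflection (ℝ ∙ (a - x))ᗮ with hR1
  set R2 := Submodule.reflection (ℝ ∙ b)ᗮ with hR2
  have d : ∀ w : E3, w ≠ 0 →
      LinearMap.det ((Submodule.reflection (ℝ ∙ w)ᗮ).toLinearEquiv : E3 →ₗ[ℝ] E3) = -1 := by
    intro w hw
    have := Submodule.det_reflection (𝕜 := ℝ) (ℝ ∙ w)ᗮ
    rw [Submodule.orthogonal_orthogonal, finrank_span_singleton hw, pow_one] at this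
    exact this
  refine ⟨R2.trans R1, ?_, ?_⟩
  · have : ((R2.trans R1).toLinearEquiv : E3 →ₗ[ℝ] E3) =
      (R1.toLinearEquiv : E3 →ₗ[ℝ] E3) ∘ₗ (R2.toLinearEquiv : E3 →ₗ[ℝ] E3) := rfl
    rw [this, LinearMap.det_comp, d _ (sub_ne_zero.2 hx), d _ hb0]
    norm_num
  · have h2 : R2 a = a := by
      rw [hR2, Submodule.reflection_eq_self_iff, Submodule.mem_orthogonal_singleton_iff_inner_right]
      simp [hb, ha, inner_smul_right, EuclideanSpace.inner_single_left]
    show R1 (R2 a) = x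
    rw [h2]
    exact Submodule.reflection_sub hax

lemma phi_radial (g : Phase → ℝ) (hg : SphSym g) (x : E3) : phiF g x = phiRad g ‖x‖ := by
  obtain ⟨R, hR, hRx⟩ := exists_rot x
  unfold phiRad
  set a : E3 := ‖x‖ • (EuclideanSpace.single (0 : Fin 3) (1:ℝ)) with ha
  have hrho : ∀ y, rhoF g (R y) = rhoF g y := by
    intro y
    unfold rhoF
    rw [← R.measurePreserving.integral_comp R.toHomeomorph.measurableEmbedding]
    exact integral_congr_ae (Eventually.of_forall fun v => hg R hR (y, v))
  unfold phiF
  rw [← R.measurePreserving.integral_comp R.toHomeomorph.measurableEmbedding]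
  congr 1
  refine integral_congr_ae (Eventually.of_forall fun y => ?_)
  dsimp only
  rw [hrho, ← hRx, ← map_sub, R.norm_map]

lemma psi_bdd (g : Phase → ℝ) (hg : memE g) (ℓ : ℝ) (hℓ : 0 < ℓ) :
    BddBelow (psiPot (phiRad g) ℓ '' Ioi 0) := by
  obtain ⟨C, hC⟩ := phi_bdd g hg
  refine ⟨-C, ?_⟩
  rintro _ ⟨r, hr, rfl⟩
  have : 0 ≤ ℓ / (2 * r ^ 2) := by positivity
  have h2 := (abs_le.1 (hC (r • (EuclideanSpace.single (0 : Fin 3) (1:ℝ))))).1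
  unfold psiPot phiRad
  linarith

lemma psi_integ (g : Phase → ℝ) (hg : memE g) (ℓ : ℝ) (hℓ : 0 < ℓ) (e : ℝ) (he : e < 0) :
    IntegrableOn (fun r => Real.sqrt (max (e - psiPot (phiRad g) ℓ r) 0)) (Ioi 0) := by
  obtain ⟨C, hC⟩ := phi_bdd g hg
  have hm : Measurable (phiRad g) := by
    refine (phi_meas g hg.1).measurable.comp ?_
    fun_prop
  have hm2 : Measurable (fun r => Real.sqrt (max (e - psiPot (phiRad g) ℓ r) 0)) := by
    unfold psiPot; fun_prop
  have hsm : Tendsto (fun r : ℝ => r • (EuclideanSpace.single (0 : Fin 3) (1:ℝ) : E3)) atTop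
      (cocompact E3) := by
    rw [← Metric.cobounded_eq_cocompact, ← tendsto_norm_atTop_iff_cobounded]
    simp only [norm_smul]
    simpa using tendsto_abs_atTop_atTop
  have ht : Tendsto (phiRad g) atTop (𝓝 0) := (phi_tendsto g hg).comp hsm
  obtain ⟨R, hR⟩ := eventually_atTop.1 (ht.eventually (lt_mem_nhds he))
  have hint : IntegrableOn (fun r : ℝ => Real.sqrt C) (Ioc 0 R) := by
    simp [integrableOn_const_iff]
  have hint2 : Integrable ((Ioc 0 R).indicator (fun r : ℝ => Real.sqrt C))
      (volume.restrict (Ioi 0)) :=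
    ((integrable_indicator_iff measurableSet_Ioc).2 hint).integrableOn
  refine hint2.mono' hm2.aestronglyMeasurable ?_
  filter_upwards [ae_restrict_mem measurableSet_Ioi] with r hr
  have hr : 0 < r := hr
  rw [Real.norm_of_nonneg (Real.sqrt_nonneg _)]
  have hp : 0 ≤ ℓ / (2 * r ^ 2) := by positivity
  by_cases h : r ≤ R
  · rw [indicator_of_mem (show r ∈ Ioc 0 R from ⟨hr, h⟩)]
    have h2 := hC (r • (EuclideanSpace.single (0 : Fin 3) (1:ℝ)))
    have h3 := (abs_le.1 h2).1
    refine Real.sqrt_le_sqrt (max_le ?_ ((abs_nonneg _).trans h2))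
    unfold psiPot phiRad
    linarith
  · rw [indicator_of_notMem (fun h' => h h'.2)]
    have h2 := hR r (not_le.1 h).le
    rw [max_eq_right, Real.sqrt_zero]
    unfold psiPot
    linarith

lemma aPot_mono (g : Phase → ℝ) (hg : memE g) (ℓ : ℝ) (hℓ : 0 < ℓ) {e e' : ℝ} (he : e' < 0)
    (h : e ≤ e') : aPot (phiRad g) e ℓ ≤ aPot (phiRad g) e' ℓ := by
  unfold aPot
  refine mul_le_mul_of_nonneg_left ?_ (by positivity)
  refine integral_mono (psi_integ g hg ℓ hℓ e (h.trans_lt he)) (psi_integ g hg ℓ hℓ e' he) ?_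
  intro r
  dsimp only
  gcongr

lemma aPot_nonneg (φ : ℝ → ℝ) (e ℓ : ℝ) : 0 ≤ aPot φ e ℓ := by
  unfold aPot
  refine mul_nonneg (by positivity) (integral_nonneg fun r => Real.sqrt_nonneg _)

lemma aPot_min (g : Phase → ℝ) (hg : memE g) (ℓ : ℝ) (hℓ : 0 < ℓ) :
    aPot (phiRad g) (eMinPot (phiRad g) ℓ) ℓ = 0 := by
  unfold aPot
  rw [setIntegral_eq_zero_of_forall_eq_zero, mul_zero]
  intro r hr
  have : eMinPot (phiRad g) ℓ ≤ psiPot (phiRad g) ℓ r :=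
    csInf_le (psi_bdd g hg ℓ hℓ) ⟨r, hr, rfl⟩
  rw [max_eq_right (by linarith), Real.sqrt_zero]

lemma schwarz_nonneg (f : Phase → ℝ) (t ℓ : ℝ) : 0 ≤ schwarz f t ℓ := by
  unfold schwarz
  split_ifs
  · exact Real.sSup_nonneg fun s hs => hs.1
  · exact le_rfl

lemma schwarz_anti (f : Phase → ℝ) (ℓ : ℝ) (hpos : 0 < schwarz f 0 ℓ) {t t' : ℝ} (h : t ≤ t') :
    schwarz f t' ℓ ≤ schwarz f t ℓ := by
  have hb : BddAbove {s : ℝ | 0 ≤ s ∧ ENNReal.ofReal 0 < muDist f s ℓ} := by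
    by_contra hb
    have := Real.sSup_of_not_bddAbove hb
    unfold schwarz at hpos
    rw [this] at hpos
    simp at hpos
  by_cases h' : ENNReal.ofReal t' < muDist f 0 ℓ
  · have h1 : ENNReal.ofReal t < muDist f 0 ℓ := (ENNReal.ofReal_le_ofReal h).trans_lt h'
    unfold schwarz
    rw [if_pos h', if_pos h1]
    refine csSup_le_csSup (hb.mono ?_) ⟨0, le_rfl, h'⟩ ?_
    · rintro s ⟨hs, hs'⟩
      exact ⟨hs, lt_of_le_of_lt (by simp) hs'⟩
    · rintro s ⟨hs, hs'⟩
      exact ⟨hs, (ENNReal.ofReal_le_ofReal h).trans_lt hs'⟩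
  · have : schwarz f t' ℓ = 0 := by unfold schwarz; rw [if_neg h']
    rw [this]; exact schwarz_nonneg _ _ _

lemma eMin_le (g : Phase → ℝ) (hg : memErad g) (ℓ : ℝ) (hℓ : 0 < ℓ) (z : Phase)
    (hz : ellOf z = ℓ) : eMinPot (phiRad g) ℓ ≤ microE g z := by
  have hx : 0 < ‖z.1‖ := by
    rcases eq_or_lt_of_le (norm_nonneg z.1) with h | h
    · exfalso
      unfold ellOf at hz
      rw [← h] at hz
      nlinarith [sq_nonneg (inner ℝ z.1 z.2 : ℝ)]
    · exact h
  have h1 : eMinPot (phiRad g) ℓ ≤ psiPot (phiRad g) ℓ ‖z.1‖ :=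
    csInf_le (psi_bdd g hg.1 ℓ hℓ) ⟨_, hx, rfl⟩
  refine h1.trans ?_
  unfold psiPot microE
  rw [phi_radial g hg.2 z.1]
  have : ℓ / (2 * ‖z.1‖ ^ 2) ≤ ‖z.2‖ ^ 2 / 2 := by
    rw [div_le_div_iff₀ (by positivity) (by norm_num)]
    unfold ellOf at hz
    nlinarith [sq_nonneg (inner ℝ z.1 z.2 : ℝ)]
  linarith

end S15

/-- Properties of the pseudo inverse of `f^* ∘ a_φ`. -/
theorem stmt15 (f g : Phase → ℝ) (hf : memErad f) (hg : memErad g)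
    (hφ : phiF g ≠ 0) (ℓ : ℝ) (hℓ : 0 < ℓ) (hpos : 0 < schwarz f 0 ℓ) :
    AntitoneOn (fun e => schwarz f (aPot (phiRad g) e ℓ) ℓ)
      (Ico (eMinPot (phiRad g) ℓ) 0) ∧
    (∀ e ∈ Ico (eMinPot (phiRad g) ℓ) 0,
      schwarz f (aPot (phiRad g) e ℓ) ℓ ∈ Icc 0 (schwarz f 0 ℓ)) ∧
    AntitoneOn (fun s => pseudoInv f g s ℓ) (Ioo 0 (schwarz f 0 ℓ)) ∧
    ∀ z : Phase, ellOf z = ℓ → ∀ s ∈ Ioo 0 (schwarz f 0 ℓ),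
      (s < rearr f g z → microE g z ≤ pseudoInv f g s ℓ) ∧
      (rearr f g z ≤ s → pseudoInv f g s ℓ ≤ microE g z) := by
  have hanti : ∀ e e' : ℝ, e' < 0 → e ≤ e' →
      schwarz f (aPot (phiRad g) e' ℓ) ℓ ≤ schwarz f (aPot (phiRad g) e ℓ) ℓ :=
    fun e e' he h => S15.schwarz_anti f ℓ hpos (S15.aPot_mono g hg.1 ℓ hℓ he h)
  have hbdd : ∀ s, BddAbove {e : ℝ | eMinPot (phiRad g) ℓ ≤ e ∧ e < 0 ∧
      s < schwarz f (aPot (phiRad g) e ℓ) ℓ} := fun s => ⟨0, fun e he => he.2.1.le⟩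
  have hne : ∀ s < schwarz f 0 ℓ, eMinPot (phiRad g) ℓ < 0 →
      {e : ℝ | eMinPot (phiRad g) ℓ ≤ e ∧ e < 0 ∧
      s < schwarz f (aPot (phiRad g) e ℓ) ℓ}.Nonempty := fun s hs h =>
    ⟨_, le_rfl, h, by rw [S15.aPot_min g hg.1 ℓ hℓ]; exact hs⟩
  refine ⟨fun e _ e' he' h => hanti e e' he'.2 h, fun e _ => ⟨S15.schwarz_nonneg _ _ _,
    S15.schwarz_anti f ℓ hpos (S15.aPot_nonneg _ _ _)⟩, ?_, ?_⟩
  · intro s hs s' hs' h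
    unfold pseudoInv
    by_cases h0 : eMinPot (phiRad g) ℓ < 0
    · exact csSup_le_csSup (hbdd s) (hne s' hs'.2 h0)
        fun e he => ⟨he.1, he.2.1, h.trans_lt he.2.2⟩
    · have : ∀ s, {e : ℝ | eMinPot (phiRad g) ℓ ≤ e ∧ e < 0 ∧
          s < schwarz f (aPot (phiRad g) e ℓ) ℓ} = ∅ := by
        intro s
        ext e
        simp only [mem_ofPred_eq, mem_empty_iff_false, iff_false]
        rintro ⟨h1, h2, _⟩
        exact h0 (h1.trans_lt h2)
      simp only [this, le_refl]
  · intro z hz s hs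
    have hmin := S15.eMin_le g hg ℓ hℓ z hz
    unfold rearr pseudoInv
    rw [hz]
    by_cases hE : microE g z < 0
    · rw [if_pos hE]
      refine ⟨fun h => le_csSup (hbdd s) ⟨hmin, hE, h⟩, fun h => ?_⟩
      refine csSup_le (hne s hs.2 (hmin.trans_lt hE)) ?_
      rintro e ⟨h1, h2, h3⟩
      by_contra hlt
      exact absurd (hanti _ _ h2 (not_le.1 hlt).le) (not_le.2 (h.trans_lt h3))
    · rw [if_neg hE]
      refine ⟨fun h => absurd h (not_lt.2 hs.1.le), fun _ => ?_⟩
      exact (Real.sSup_nonpos fun e he => he.2.1.le).trans (not_lt.1 hE)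
end
end
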